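/- arXiv:math/0012190 — 3 statements merged into one kernel-verified Lean document; each statement's English description precedes it below -/
import Mathlib

section
/- Let f be a polynomial in variables x_1, …, x_m, y_1, …, y_n over a field of characteristic zero, symmetric separately in the x variables and in the y variables, such that f vanishes whenever x_1 = x_2 = y_1 and whenever x_1 = y_1 = y_2 (assuming m ≥ 2, n ≥ 1 for the first and m ≥ 1, n ≥ 2 for the second). Then for every t ≥ 0 with m ≥ t+2 and n ≥ 1, the restriction of (∂/∂y_1)^t f to x_1 = ⋯ = x_{t+2} = y_1 = z is identically zero as a function of z and the remaining variables. -/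
open MvPolynomial

lemma deriv_pow_mem {A : Type*} [CommRing A] [Algebra ℚ A] (D : Derivation ℚ A A) (I : Ideal A)
    (k : ℕ) (a : A) (ha : a ∈ I ^ (k + 1)) : D a ∈ I ^ k := by
  induction k generalizing a with
  | zero => simp
  | succ k ih =>
    rw [pow_succ] at ha
    refine Submodule.mul_induction_on ha ?_ ?_
    · intro x hx y hy
      rw [D.leibniz, smul_eq_mul, smul_eq_mul]
      refine Ideal.add_mem _ (Ideal.mul_mem_right _ _ hx) ?_
      rw [pow_succ']
      exact Ideal.mul_mem_mul hy (ih x hx)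
    · intro x y hx hy
      rw [map_add]; exact Ideal.add_mem _ hx hy

lemma deriv_iter_mem {A : Type*} [CommRing A] [Algebra ℚ A] (D : Derivation ℚ A A) (I : Ideal A)
    (k : ℕ) (a : A) (ha : a ∈ I ^ (k + 1)) : (⇑D)^[k] a ∈ I := by
  induction k generalizing a with
  | zero => simpa using ha
  | succ k ih =>
    rw [Function.iterate_succ_apply]
    exact ih _ (deriv_pow_mem D I (k + 1) a ha)

lemma supp_of_kill {τ : Type*} [DecidableEq τ] (a b : τ) (G : MvPolynomial τ ℚ)
    (h : aeval (fun v => if v = a ∨ v = b then (0 : MvPolynomial τ ℚ) else X v) G = 0)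
    (d : τ →₀ ℕ) (hd : d ∈ G.support) : d a ≠ 0 ∨ d b ≠ 0 := by
  have key : G ∈ Ideal.span ((X : τ → MvPolynomial τ ℚ) '' {a, b}) := by
    rw [← Ideal.Quotient.eq_zero_iff_mem]
    have e : (Ideal.Quotient.mkₐ ℚ (Ideal.span ((X : τ → MvPolynomial τ ℚ) '' {a, b}))).comp
        (aeval (fun v => if v = a ∨ v = b then (0 : MvPolynomial τ ℚ) else X v)) =
        Ideal.Quotient.mkₐ ℚ _ := by
      apply MvPolynomial.algHom_ext
      intro v
      simp only [AlgHom.comp_apply, aeval_X]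
      split_ifs with hv
      · rw [map_zero]; symm
        rw [Ideal.Quotient.mkₐ_eq_mk, Ideal.Quotient.eq_zero_iff_mem]
        exact Ideal.subset_span ⟨v, by simpa using hv, rfl⟩
      · rfl
    have := DFunLike.congr_fun e G
    rw [AlgHom.comp_apply, h, map_zero] at this
    exact this.symm
  rw [mem_ideal_span_X_image] at key
  obtain ⟨i, hi, h'⟩ := key d hd
  rcases hi with rfl | hi
  · exact Or.inl h'
  · rw [Set.mem_singleton_iff] at hi; subst hi; exact Or.inr h'

lemma perm_pair {m : ℕ} (p q i j : Fin m) (hpq : p ≠ q) (hij : i ≠ j) :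
    ∃ σ : Equiv.Perm (Fin m), σ p = i ∧ σ q = j := by
  refine ⟨Equiv.swap (Equiv.swap p i q) j * Equiv.swap p i, ?_, ?_⟩
  · simp only [Equiv.Perm.mul_apply, Equiv.swap_apply_left]
    apply Equiv.swap_apply_of_ne_of_ne _ hij
    intro h
    apply hpq
    apply (Equiv.swap p i).injective
    rw [← h, Equiv.swap_apply_left]
  · simp

lemma aux_prod_mem {m n t : ℕ} (hm : t + 2 ≤ m) (I : Ideal (MvPolynomial (Fin m ⊕ Fin n) ℚ))
    (ψ : Fin m ⊕ Fin n → MvPolynomial (Fin m ⊕ Fin n) ℚ)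
    (hψ : ∀ i : Fin m, (i : ℕ) < t + 2 → ψ (Sum.inl i) ∈ I)
    (d : (Fin m ⊕ Fin n) →₀ ℕ)
    (hd : ∀ i j : Fin m, (i : ℕ) < t + 2 → (j : ℕ) < t + 2 → i ≠ j →
      d (Sum.inl i) ≠ 0 ∨ d (Sum.inl j) ≠ 0) :
    (d.prod fun v k => ψ v ^ k) ∈ I ^ (t + 1) := by
  classical
  let g : Fin (t + 2) → Fin m ⊕ Fin n := fun i => Sum.inl (Fin.castLE hm i)
  have hg : Function.Injective g := fun a b h => by
    simpa [g] using h
  let S : Finset (Fin (t + 2)) := Finset.univ.filter (fun i => d (g i) ≠ 0)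
  have hS : t + 1 ≤ S.card := by
    have h1 : Sᶜ.card ≤ 1 := by
      rw [Finset.card_le_one]
      intro a ha b hb
      by_contra hne
      have := hd (Fin.castLE hm a) (Fin.castLE hm b) a.2 b.2 (by simpa using hne)
      simp only [S, g, Finset.mem_compl, Finset.mem_filter, Finset.mem_univ, true_and,
        not_not] at ha hb
      tauto
    have h2 := Finset.card_add_card_compl S
    simp only [Fintype.card_fin] at h2
    omega
  have h3 : ∏ i ∈ S, ψ (g i) ∈ I ^ (t + 1) := by
    apply Ideal.pow_le_pow_right hS
    have := Ideal.prod_mem_prod (s := S) (I := fun _ => I) (x := fun i => ψ (g i))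
      (fun i _ => hψ _ i.2)
    simpa using this
  refine Ideal.mem_of_dvd _ ?_ h3
  have h4 : ∏ i ∈ S, ψ (g i) ∣ ∏ i ∈ S, ψ (g i) ^ d (g i) := by
    apply Finset.prod_dvd_prod_of_dvd
    intro i hi
    exact dvd_pow_self _ (by simpa [S] using hi)
  refine h4.trans ?_
  have h5 : ∏ i ∈ S, ψ (g i) ^ d (g i) = ∏ v ∈ S.image g, ψ v ^ d v := by
    rw [Finset.prod_image]
    exact fun a _ b _ h => hg h
  rw [h5]
  apply Finset.prod_dvd_prod_of_subset
  intro v hv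
  obtain ⟨i, hi, rfl⟩ := Finset.mem_image.1 hv
  simpa [S] using hi



/-- if `f` is a polynomial in `x_1,…,x_m, y_1,…,y_n` over `ℚ`, symmetric
separately in the `x` and in the `y` variables, vanishing whenever `x₁ = x₂ = y₁` and
whenever `x₁ = y₁ = y₂`, then for every `t ≥ 0` with `m ≥ t+2`, `n ≥ 1`, the
restriction of `(∂/∂y₁)^t f` to `x₁ = ⋯ = x_{t+2} = y₁ = z` (a common value) vanishes
identically.  Variables are indexed by `Fin m ⊕ Fin n` (`inl` = `x`, `inr` = `y`);
the common value `z` is realized as the variable `x₁`. -/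
theorem stmt4 (m n : ℕ) (f : MvPolynomial (Fin m ⊕ Fin n) ℚ)
    (hx : ∀ σ : Equiv.Perm (Fin m), rename (Sum.map σ id) f = f)
    (hy : ∀ σ : Equiv.Perm (Fin n), rename (Sum.map id σ) f = f)
    (hserre1 : ∀ (hm : 2 ≤ m) (hn : 1 ≤ n),
      aeval (fun v : Fin m ⊕ Fin n =>
        if v = Sum.inl ⟨1, hm⟩ ∨ v = Sum.inr ⟨0, hn⟩
        then (X (Sum.inl (⟨0, by omega⟩ : Fin m)) : MvPolynomial (Fin m ⊕ Fin n) ℚ) else X v) f = 0)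
    (hserre2 : ∀ (hm : 1 ≤ m) (hn : 2 ≤ n),
      aeval (fun v : Fin m ⊕ Fin n =>
        if v = Sum.inr (⟨0, by omega⟩ : Fin n) ∨ v = Sum.inr ⟨1, hn⟩
        then (X (Sum.inl (⟨0, hm⟩ : Fin m)) : MvPolynomial (Fin m ⊕ Fin n) ℚ) else X v) f = 0)
    (t : ℕ) (hm : t + 2 ≤ m) (hn : 1 ≤ n) :
    aeval (Sum.elim
        (fun i : Fin m => if (i : ℕ) < t + 2
          then (X (Sum.inl (⟨0, by omega⟩ : Fin m)) : MvPolynomial (Fin m ⊕ Fin n) ℚ)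
          else X (Sum.inl i))
        (fun j : Fin n => if (j : ℕ) = 0
          then (X (Sum.inl (⟨0, by omega⟩ : Fin m)) : MvPolynomial (Fin m ⊕ Fin n) ℚ)
          else X (Sum.inr j)))
      ((⇑(pderiv (Sum.inr (⟨0, hn⟩ : Fin n))))^[t] f) = 0 := by
  classical
  have hm2 : 2 ≤ m := by omega
  have h1 := hserre1 hm2 hn
  set y : Fin m ⊕ Fin n := Sum.inr ⟨0, hn⟩ with hydef
  -- general vanishing
  have van : ∀ (i j : Fin m), i ≠ j → ∀ θ : Fin m ⊕ Fin n → MvPolynomial (Fin m ⊕ Fin n) ℚ,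
      θ (Sum.inl i) = θ y → θ (Sum.inl j) = θ y → aeval θ f = 0 := by
    intro i j hij θ hi hj
    obtain ⟨σ, h0, h1'⟩ := perm_pair (⟨0, by omega⟩ : Fin m) ⟨1, hm2⟩ i j (by simp) hij
    rw [← hx σ, aeval_rename]
    have h2 := congrArg (aeval (R := ℚ) (θ ∘ Sum.map σ id)) h1
    rw [map_zero, ← AlgHom.comp_apply, comp_aeval] at h2
    rw [← h2]
    congr 2
    funext v
    split_ifs with hv
    · rcases hv with rfl | rfl
      · simp [h0, h1', hi, hj]
      · simp [h0, hi, hydef]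
    · simp
  let u : Fin m ⊕ Fin n → MvPolynomial (Fin m ⊕ Fin n) ℚ :=
    Sum.elim (fun i => if (i : ℕ) < t + 2 then X y else 0) (fun _ => 0)
  have huy : u y = 0 := rfl
  let φ : Fin m ⊕ Fin n → MvPolynomial (Fin m ⊕ Fin n) ℚ := fun v => X v + u v
  let ψ : Fin m ⊕ Fin n → MvPolynomial (Fin m ⊕ Fin n) ℚ := fun v => X v - u v
  have hfix : ∀ v, aeval ψ (u v) = u v := by
    rintro (i | j)
    · simp only [u, Sum.elim_inl]
      split_ifs
      · rw [aeval_X]; simp [ψ, huy]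
      · simp
    · simp [u]
  have hinv : aeval ψ (aeval φ f) = f := by
    have : (aeval ψ).comp (aeval φ) = AlgHom.id ℚ (MvPolynomial (Fin m ⊕ Fin n) ℚ) := by
      apply MvPolynomial.algHom_ext
      intro v
      simp only [AlgHom.comp_apply, aeval_X, AlgHom.id_apply]
      change aeval ψ (X v + u v) = X v
      rw [map_add, hfix, aeval_X]
      simp [ψ]
    exact DFunLike.congr_fun this f
  have hsupp : ∀ d ∈ (aeval φ f).support, ∀ i j : Fin m, (i : ℕ) < t + 2 → (j : ℕ) < t + 2 →
      i ≠ j → d (Sum.inl i) ≠ 0 ∨ d (Sum.inl j) ≠ 0 := by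
    intro d hd i j hi hj hij
    refine supp_of_kill (Sum.inl i) (Sum.inl j) (aeval φ f) ?_ d hd
    rw [← AlgHom.comp_apply, comp_aeval]
    apply van i j hij
    · simp [φ, u, hi, hydef]
    · simp [φ, u, hj, hydef]
  generalize hR : (aeval (Sum.elim
        (fun i : Fin m => if (i : ℕ) < t + 2
          then (X (Sum.inl (⟨0, by omega⟩ : Fin m)) : MvPolynomial (Fin m ⊕ Fin n) ℚ)
          else X (Sum.inl i))
        (fun j : Fin n => if (j : ℕ) = 0
          then (X (Sum.inl (⟨0, by omega⟩ : Fin m)) : MvPolynomial (Fin m ⊕ Fin n) ℚ)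
          else X (Sum.inr j))) : MvPolynomial (Fin m ⊕ Fin n) ℚ →ₐ[ℚ] _) = R
  have hψ : ∀ i : Fin m, (i : ℕ) < t + 2 → ψ (Sum.inl i) ∈ RingHom.ker R := by
    intro i hi
    rw [RingHom.mem_ker, ← hR]
    simp [ψ, u, hi, hydef]
  have hf : f ∈ RingHom.ker R ^ (t + 1) := by
    rw [← hinv, (aeval φ f).as_sum, map_sum]
    refine Ideal.sum_mem _ fun d hd => ?_
    rw [aeval_monomial]
    exact Ideal.mul_mem_left _ _ (aux_prod_mem hm _ ψ hψ d (hsupp d hd))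
  exact deriv_iter_mem (pderiv y) (RingHom.ker R) t f hf
end

section
/- Let f be a polynomial symmetric separately in x_1,…,x_m and y_1,…,y_n satisfying the Serre relations (f = 0 if x_1 = x_2 = y_1 or x_1 = y_1 = y_2). Then for all s, t ≥ 0 (with enough variables available), the mixed partial derivative of f given by applying (∂/∂x_i)^{i−1} for i = 1,…,s, then (∂/∂x_{s+1})^s and (∂/∂x_{s+j})^s for j = 2,…,t+2, and (∂/∂y_i)^{i−1} for i = 1,…,s, and (∂/∂y_{s+1})^{s+t}, vanishes identically after setting all these x and y variables equal to a common value z. (This is the identity [0,1,2,…,s,s,s^t; 0,1,2,…,s−1,s+t]f = 0.) -/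
open MvPolynomial

/-- Apply `(∂/∂x_i)^{e i}` for every `x`-variable `i` (in order). -/
noncomputable def mderivX (m n : ℕ) (e : Fin m → ℕ)
    (f : MvPolynomial (Fin m ⊕ Fin n) ℚ) : MvPolynomial (Fin m ⊕ Fin n) ℚ :=
  (List.finRange m).foldl (fun g i => (⇑(pderiv (Sum.inl i)))^[e i] g) f

/-- Apply `(∂/∂y_j)^{e j}` for every `y`-variable `j` (in order). -/
noncomputable def mderivY (m n : ℕ) (e : Fin n → ℕ)
    (f : MvPolynomial (Fin m ⊕ Fin n) ℚ) : MvPolynomial (Fin m ⊕ Fin n) ℚ :=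
  (List.finRange n).foldl (fun g j => (⇑(pderiv (Sum.inr j)))^[e j] g) f


def T5 (d : ℕ) : Finset (ℕ × ℕ × ℕ) :=
  ((Finset.range (d+1)) ×ˢ (Finset.range (d+1)) ×ˢ (Finset.range (d+1))).filter
    (fun x => x.1 + x.2.1 + x.2.2 = d)

lemma mem_T5 (d : ℕ) (x : ℕ × ℕ × ℕ) : x ∈ T5 d ↔ x.1 + x.2.1 + x.2.2 = d := by
  simp [T5]; omega

lemma T5_shift (d : ℕ) (G : ℕ × ℕ × ℕ → ℚ)
    (h : ∀ x, x.1 = 0 ∨ x.2.1 = 0 ∨ x.2.2 = 0 → G x = 0) :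
    ∑ x ∈ T5 d, G (x.1+1, x.2.1+1, x.2.2+1) = ∑ x ∈ T5 (d+3), G x := by
  refine Finset.sum_bij_ne_zero (fun x _ _ => (x.1+1, x.2.1+1, x.2.2+1)) ?_ ?_ ?_ ?_
  · intro x hx _
    rw [mem_T5] at *; simp; omega
  · rintro ⟨a, b, c⟩ _ _ ⟨a', b', c'⟩ _ _ h
    simpa using h
  · rintro ⟨a, b, c⟩ hb hne
    rw [mem_T5] at hb
    have := mt (h (a, b, c)) hne
    simp only [not_or] at this hb
    refine ⟨(a-1, b-1, c-1), ?_, ?_, ?_⟩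
    · rw [mem_T5]; simp; omega
    · have e : (a-1+1, b-1+1, c-1+1) = (a,b,c) := by
        simp; omega
      simpa only [e] using hne
    · simp; omega
  · intros; rfl

structure Serre5 (c : Multiset ℕ → Multiset ℕ → ℚ) : Prop where
  s1 : ∀ A B d, ∑ x ∈ T5 d, c (x.1 ::ₘ x.2.1 ::ₘ A) (x.2.2 ::ₘ B) = 0
  s2 : ∀ A B d, ∑ x ∈ T5 d, c (x.1 ::ₘ A) (x.2.1 ::ₘ x.2.2 ::ₘ B) = 0

lemma T5_zero : T5 0 = {(0,0,0)} := by
  decide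

lemma Serre5.z1 {c} (h : Serre5 c) (A B) : c (0 ::ₘ 0 ::ₘ A) (0 ::ₘ B) = 0 := by
  simpa [T5_zero] using h.s1 A B 0

lemma Serre5.z2 {c} (h : Serre5 c) (A B) : c (0 ::ₘ A) (0 ::ₘ 0 ::ₘ B) = 0 := by
  simpa [T5_zero] using h.s2 A B 0

lemma Serre5.shift {c} (h : Serre5 c) :
    Serre5 (fun A B => c (0 ::ₘ A.map (· + 1)) (0 ::ₘ B.map (· + 1))) := by
  constructor
  · intro A B d
    have key := h.s1 (0 ::ₘ A.map (· + 1)) (0 ::ₘ B.map (· + 1)) (d+3)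
    rw [← T5_shift d (fun x => c (x.1 ::ₘ x.2.1 ::ₘ 0 ::ₘ A.map (· + 1)) (x.2.2 ::ₘ 0 ::ₘ B.map (· + 1)))] at key
    · rw [← key]
      refine Finset.sum_congr rfl fun x _ => ?_
      simp only [Multiset.map_cons]
      congr 1
      · rw [Multiset.cons_swap, Multiset.cons_swap 0]
      · rw [Multiset.cons_swap]
    · rintro ⟨i, j, k⟩ (rfl | rfl | rfl) <;> simp only
      · rw [Multiset.cons_swap j, Multiset.cons_swap k]; exact h.z1 _ _
      · rw [Multiset.cons_swap i, Multiset.cons_swap i, Multiset.cons_swap k]; exact h.z1 _ _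
      · rw [Multiset.cons_swap j, Multiset.cons_swap i]; exact h.z2 _ _
  · intro A B d
    have key := h.s2 (0 ::ₘ A.map (· + 1)) (0 ::ₘ B.map (· + 1)) (d+3)
    rw [← T5_shift d (fun x => c (x.1 ::ₘ 0 ::ₘ A.map (· + 1)) (x.2.1 ::ₘ x.2.2 ::ₘ 0 ::ₘ B.map (· + 1)))] at key
    · rw [← key]
      refine Finset.sum_congr rfl fun x _ => ?_
      simp only [Multiset.map_cons]
      congr 1
      · rw [Multiset.cons_swap]
      · rw [Multiset.cons_swap, Multiset.cons_swap 0]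
    · rintro ⟨i, j, k⟩ (rfl | rfl | rfl) <;> simp only
      · rw [Multiset.cons_swap k, Multiset.cons_swap j]; exact h.z1 _ _
      · rw [Multiset.cons_swap k, Multiset.cons_swap i]; exact h.z2 _ _
      · rw [Multiset.cons_swap j, Multiset.cons_swap j, Multiset.cons_swap i]; exact h.z2 _ _

lemma Serre5.base {c} (h : Serre5 c) (t : ℕ) : ∀ A B,
    c (Multiset.replicate (t+2) 0 + A) (t ::ₘ B) = 0 := by
  induction t using Nat.strong_induction_on with
  | _ t ih =>
  intro A B
  have ih' : ∀ k < t, ∀ r, k + 2 ≤ r → ∀ A B, c (Multiset.replicate r 0 + A) (k ::ₘ B) = 0 := by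
    intro k hk r hr A B
    obtain ⟨q, rfl⟩ := Nat.exists_eq_add_of_le hr
    rw [Multiset.replicate_add, add_assoc]
    exact ih k hk _ _
  have key := h.s1 (Multiset.replicate t 0 + A) B t
  rw [Finset.sum_eq_single (0,0,t)] at key
  · simpa [Multiset.replicate_succ] using key
  · rintro ⟨i, j, k⟩ hx hne
    rw [mem_T5] at hx
    simp only at hx ⊢
    have hk : k < t := by
      by_contra hc
      apply hne
      simp; omega
    rcases Nat.eq_zero_or_pos i with rfl | hi
    · rw [Multiset.cons_swap]
      have := ih' k hk (t+1) (by omega) (j ::ₘ A) B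
      rwa [Multiset.add_cons, Multiset.replicate_succ, Multiset.cons_add] at this
    · rcases Nat.eq_zero_or_pos j with rfl | hj
      · have := ih' k hk (t+1) (by omega) (i ::ₘ A) B
        rwa [Multiset.add_cons, Multiset.replicate_succ, Multiset.cons_add] at this
      · have := ih' k hk t (by omega) (i ::ₘ j ::ₘ A) B
        rwa [Multiset.add_cons, Multiset.add_cons] at this
  · intro hx
    exact absurd ((mem_T5 _ _).2 (by simp)) hx

lemma exists_map_succ5 (A : Multiset ℕ) (h : 0 ∉ A) : ∃ A' : Multiset ℕ, A = A'.map (· + 1) := by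
  refine ⟨A.map (· - 1), ?_⟩
  rw [Multiset.map_map]
  conv_lhs => rw [← Multiset.map_id A]
  refine Multiset.map_congr rfl fun x hx => ?_
  have : x ≠ 0 := fun h0 => h (h0 ▸ hx)
  simp; omega

lemma range_succ5 (s : ℕ) : Multiset.range (s+1) = 0 ::ₘ (Multiset.range s).map (· + 1) := by
  simp only [Multiset.range, Multiset.map_coe, Multiset.cons_coe]
  rw [List.range_succ_eq_map]

lemma Serre5.main (s t : ℕ) : ∀ {c} (_ : Serre5 c) (A B),
    c (Multiset.range s + Multiset.replicate (t+2) s + A) ((s + t) ::ₘ (Multiset.range s + B)) = 0 := by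
  induction s with
  | zero =>
    intro c h A B
    simpa using h.base t A B
  | succ s ih =>
    intro c h A B
    by_cases hA : 0 ∈ A
    · obtain ⟨A', rfl⟩ := Multiset.exists_cons_of_mem hA
      rw [range_succ5, Multiset.add_cons, Multiset.cons_add, Multiset.cons_add, Multiset.cons_add, Multiset.cons_swap (s+1+t)]
      exact h.z1 _ _
    by_cases hB : 0 ∈ B
    · obtain ⟨B', rfl⟩ := Multiset.exists_cons_of_mem hB
      rw [range_succ5, Multiset.add_cons, Multiset.cons_add, Multiset.cons_add, Multiset.cons_add, Multiset.cons_swap (s+1+t), Multiset.cons_swap (s+1+t)]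
      exact h.z2 _ _
    obtain ⟨A, rfl⟩ := exists_map_succ5 A hA
    obtain ⟨B, rfl⟩ := exists_map_succ5 B hB
    have := ih h.shift A B
    rw [← this, range_succ5]
    congr 1
    · simp only [Multiset.map_add, Multiset.map_replicate, Multiset.cons_add]
    · simp only [Multiset.map_add, Multiset.map_cons, Multiset.cons_add]
      rw [Multiset.cons_swap, show s + 1 + t = s + t + 1 by omega]

lemma coeff_rename5 {σ : Type*} [Fintype σ] [DecidableEq σ] (p q r : σ) (hpq : p ≠ q) (hpr : p ≠ r)
    (hqr : q ≠ r) (E : ℕ → ℕ → ℕ → (σ →₀ ℕ)) (hp : ∀ i j k, E i j k p = i)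
    (hq : ∀ i j k, E i j k q = j) (hr : ∀ i j k, E i j k r = k)
    (ho : ∀ i j k v, v ≠ p → v ≠ q → v ≠ r → E i j k v = E 0 0 0 v)
    (F : MvPolynomial σ ℚ) (d : ℕ) :
    ∑ x ∈ T5 d, coeff (E x.1 x.2.1 x.2.2) F
      = coeff (E d 0 0) (rename (fun v => if v = q ∨ v = r then p else v) F) := by
  induction F using MvPolynomial.induction_on' with
  | add f g hf hg => simp only [coeff_add, Finset.sum_add_distrib, hf, hg, map_add]
  | monomial e a =>
    rw [rename_monomial]
    simp only [coeff_monomial]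
    set g : σ → σ := fun v => if v = q ∨ v = r then p else v with hg
    have hmap : ∀ w, Finsupp.mapDomain g e w = ∑ v, if g v = w then e v else 0 := by
      intro w
      rw [Finsupp.mapDomain, Finsupp.sum_apply, Finsupp.sum_fintype]
      · simp [Finsupp.single_apply]
      · simp
    have h1 : Finsupp.mapDomain g e p = e p + e q + e r := by
      rw [hmap, ← Finset.sum_filter]
      have : Finset.univ.filter (fun v => g v = p) = {p, q, r} := by
        ext v; simp [hg]; tauto
      rw [this, Finset.sum_insert, Finset.sum_pair hqr, add_assoc]
      simp [hpq, hpr]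
    have h2 : Finsupp.mapDomain g e q = 0 := by
      rw [hmap]
      refine Finset.sum_eq_zero fun v _ => if_neg ?_
      simp only [hg]; split_ifs with h
      · exact hpq
      · tauto
    have h3 : Finsupp.mapDomain g e r = 0 := by
      rw [hmap]
      refine Finset.sum_eq_zero fun v _ => if_neg ?_
      simp only [hg]; split_ifs with h
      · exact hpr
      · tauto
    have h4 : ∀ w, w ≠ p → w ≠ q → w ≠ r → Finsupp.mapDomain g e w = e w := by
      intro w a b c
      rw [hmap, Finset.sum_eq_single w]
      · simp [hg, b, c]
      · intro v _ hv
        rw [if_neg]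
        simp only [hg]; split_ifs with h
        · exact a.symm
        · exact hv
      · simp
    by_cases hc : Finsupp.mapDomain g e = E d 0 0
    · rw [if_pos hc]
      have hE : e = E (e p) (e q) (e r) := by
        ext v
        by_cases hvp : v = p
        · subst hvp; rw [hp]
        by_cases hvq : v = q
        · subst hvq; rw [hq]
        by_cases hvr : v = r
        · subst hvr; rw [hr]
        rw [← h4 v hvp hvq hvr, hc, ho _ _ _ v hvp hvq hvr, ho (e p) _ _ v hvp hvq hvr]
      rw [Finset.sum_eq_single (e p, e q, e r)]
      · rw [if_pos hE]
      · rintro ⟨i, j, k⟩ _ hne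
        rw [if_neg]
        intro h
        apply hne
        simp only at h
        rw [h, hp, hq, hr]
      · intro h
        exact absurd ((mem_T5 _ _).2 (by rw [← h1, hc, hp])) h
    · rw [if_neg hc]
      refine Finset.sum_eq_zero ?_
      rintro ⟨i, j, k⟩ hx
      rw [mem_T5] at hx
      simp only at hx ⊢
      rw [if_neg]
      intro h
      apply hc
      ext v
      by_cases hvp : v = p
      · subst hvp; rw [h1, h, hp, hp, hq, hr, hx]
      by_cases hvq : v = q
      · subst hvq; rw [h2, hq]
      by_cases hvr : v = r
      · subst hvr; rw [h3, hr]
      rw [h4 v hvp hvq hvr, h, ho _ _ _ v hvp hvq hvr, ho d _ _ v hvp hvq hvr]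

lemma iter_pderiv5 {σ : Type*} (v : σ) (e : σ →₀ ℕ) (a : ℚ) (k : ℕ) :
    (⇑(pderiv v))^[k] (monomial e a) =
      monomial (e - Finsupp.single v k) (a * ((e v).descFactorial k : ℚ)) := by
  induction k with
  | zero => simp
  | succ k ih =>
    rw [Function.iterate_succ_apply', ih, pderiv_monomial, Nat.descFactorial_succ]
    congr 1
    · rw [tsub_tsub, ← Finsupp.single_add]
    · simp; ring

lemma foldl_monomial5 {σ : Type*} [DecidableEq σ] (d : σ → ℕ) (l : List σ) (hl : l.Nodup) :
    ∀ (e : σ →₀ ℕ) (a : ℚ), ∃ (e' : σ →₀ ℕ) (a' : ℚ),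
      l.foldl (fun g v => (⇑(pderiv v))^[d v] g) (monomial e a) = monomial e' a' ∧
      (∀ v ∈ l, e' v = e v - d v) ∧ (∀ v, v ∉ l → e' v = e v) ∧
      (a = 0 → a' = 0) ∧ (∀ v ∈ l, e v < d v → a' = 0) := by
  induction l with
  | nil => intro e a; exact ⟨e, a, by simp⟩
  | cons w l ih =>
    intro e a
    rw [List.nodup_cons] at hl
    obtain ⟨e', a', h0, h1, h2, h3, h4⟩ :=
      ih hl.2 (e - Finsupp.single w (d w)) (a * ((e w).descFactorial (d w) : ℚ))
    have hne : ∀ v ∈ l, w ≠ v := fun v hv h => hl.1 (h ▸ hv)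
    refine ⟨e', a', ?_, ?_, ?_, ?_, ?_⟩
    · rw [List.foldl_cons, iter_pderiv5, h0]
    · intro v hv
      rcases List.mem_cons.1 hv with rfl | hv
      · rw [h2 _ hl.1]; simp
      · rw [h1 _ hv]; simp [Finsupp.single_apply, hne v hv]
    · intro v hv
      rw [List.mem_cons, not_or] at hv
      rw [h2 v hv.2]; simp [Finsupp.single_apply, Ne.symm hv.1]
    · intro ha; apply h3; simp [ha]
    · intro v hv hlt
      rcases List.mem_cons.1 hv with rfl | hv
      · apply h3; rw [Nat.descFactorial_eq_zero_iff_lt.2 hlt]; simp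
      · apply h4 v hv; simpa [Finsupp.single_apply, hne v hv] using hlt

lemma foldl_linear5 {σ : Type*} (d : σ → ℕ) (l : List σ) :
    ∃ L : MvPolynomial σ ℚ →ₗ[ℚ] MvPolynomial σ ℚ, ∀ g,
      l.foldl (fun g v => (⇑(pderiv v))^[d v] g) g = L g := by
  induction l with
  | nil => exact ⟨LinearMap.id, fun g => rfl⟩
  | cons w l ih =>
    obtain ⟨L, hL⟩ := ih
    refine ⟨L ∘ₗ (((pderiv w : Derivation ℚ _ _) : MvPolynomial σ ℚ →ₗ[ℚ] MvPolynomial σ ℚ) ^ (d w)), fun g => ?_⟩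
    rw [List.foldl_cons, hL, LinearMap.comp_apply, Module.End.pow_apply]
    rfl

lemma eval_foldl5 {σ : Type*} [DecidableEq σ] (d : σ → ℕ) (l : List σ) (hl : l.Nodup)
    (hmem : ∀ v, v ∈ l) (F : MvPolynomial σ ℚ) (P : σ → Prop) (q : σ → ℚ) (hq : ∀ v, P v → q v = 0)
    (hF : ∀ e : σ →₀ ℕ, (∀ v, P v → e v = d v) → coeff e F = 0) :
    eval q (l.foldl (fun g v => (⇑(pderiv v))^[d v] g) F) = 0 := by
  obtain ⟨L, hL⟩ := foldl_linear5 d l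
  rw [hL, F.as_sum, map_sum, map_sum]
  refine Finset.sum_eq_zero fun e he => ?_
  rw [← hL]
  obtain ⟨e', a', h0, h1, -, -, h4⟩ := foldl_monomial5 d l hl e (coeff e F)
  rw [h0]
  by_cases h : ∀ v, P v → e v = d v
  · exact absurd (hF e h) (mem_support_iff.1 he)
  push Not at h
  obtain ⟨v, hv, hne⟩ := h
  rcases lt_or_gt_of_ne hne with hlt | hgt
  · rw [h4 v (hmem v) hlt]; simp
  · rw [eval_monomial, Finsupp.prod]
    have : v ∈ e'.support := by
      rw [Finsupp.mem_support_iff, h1 v (hmem v)]; omega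
    rw [Finset.prod_eq_zero this, mul_zero]
    rw [hq v hv, zero_pow (Finsupp.mem_support_iff.1 this)]

noncomputable def shift5 {σ : Type*} (z : ℚ) : MvPolynomial σ ℚ →ₐ[ℚ] MvPolynomial σ ℚ :=
  aeval (fun v => X v + C z)

lemma shift_pderiv5 {σ : Type*} [DecidableEq σ] (z : ℚ) (v : σ) (g : MvPolynomial σ ℚ) :
    shift5 z (pderiv v g) = pderiv v (shift5 z g) := by
  induction g using MvPolynomial.induction_on with
  | C a => simp [shift5]
  | add f g hf hg => simp [hf, hg]
  | mul_X f i hf =>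
    simp only [map_mul, Derivation.leibniz, map_add, smul_eq_mul, hf]
    congr 1
    simp [shift5, pderiv_X, Pi.single_apply]

lemma shift_iter5 {σ : Type*} [DecidableEq σ] (z : ℚ) (v : σ) (k : ℕ) (g : MvPolynomial σ ℚ) :
    shift5 z ((⇑(pderiv v))^[k] g) = (⇑(pderiv v))^[k] (shift5 z g) := by
  induction k generalizing g with
  | zero => rfl
  | succ k ih => rw [Function.iterate_succ_apply, Function.iterate_succ_apply, ih, shift_pderiv5]

lemma shift_foldl5 {σ : Type*} [DecidableEq σ] (z : ℚ) (d : σ → ℕ) (l : List σ) :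
    ∀ (g : MvPolynomial σ ℚ), shift5 z (l.foldl (fun g v => (⇑(pderiv v))^[d v] g) g) =
      l.foldl (fun g v => (⇑(pderiv v))^[d v] g) (shift5 z g) := by
  induction l with
  | nil => intro g; rfl
  | cons w l ih => intro g; rw [List.foldl_cons, List.foldl_cons, ih, shift_iter5]

lemma shift_rename5 {σ : Type*} (z : ℚ) (φ : σ → σ) (g : MvPolynomial σ ℚ) :
    shift5 z (rename φ g) = rename φ (shift5 z g) := by
  have : (shift5 z).comp (rename φ) = (rename φ).comp (shift5 (σ := σ) z) := by
    ext v; simp [shift5]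
  exact DFunLike.congr_fun this g

lemma eval_shift5 {σ : Type*} (z : ℚ) (p : σ → ℚ) (g : MvPolynomial σ ℚ) :
    eval p g = eval (fun v => p v - z) (shift5 z g) := by
  induction g using MvPolynomial.induction_on with
  | C a => simp [shift5]
  | add f g hf hg => simp only [map_add, hf, hg]
  | mul_X f i hf => simp only [map_mul, hf]; simp [shift5]

lemma exists_perm5 {m : ℕ} (a b : Fin m → ℕ)
    (h : Finset.univ.val.map a = Finset.univ.val.map b) :
    ∃ σ : Equiv.Perm (Fin m), ∀ i, b (σ i) = a i := by
  have hc : ∀ x, Nonempty ({i // a i = x} ≃ {i // b i = x}) := by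
    intro x
    refine ⟨Fintype.equivOfCardEq ?_⟩
    have := congrArg (Multiset.count x) h
    rw [Multiset.count_map, Multiset.count_map] at this
    rw [Fintype.card_subtype, Fintype.card_subtype]
    simp only [Finset.card_def, Finset.filter_val]
    simpa only [eq_comm] using this
  let E := fun x => (hc x).some
  exact ⟨Equiv.ofFiberEquiv E, fun i => Equiv.ofFiberEquiv_map E i⟩

noncomputable def cc5 (m n : ℕ) (F : MvPolynomial (Fin m ⊕ Fin n) ℚ) (A B : Multiset ℕ) : ℚ :=
  open Classical in
  if h : ∃ e : Fin m ⊕ Fin n →₀ ℕ, Finset.univ.val.map (fun i => e (Sum.inl i)) = A ∧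
    Finset.univ.val.map (fun i => e (Sum.inr i)) = B then coeff h.choose F else 0

lemma cc5_eq {m n : ℕ} {F : MvPolynomial (Fin m ⊕ Fin n) ℚ}
    (hx : ∀ σ : Equiv.Perm (Fin m), rename (Sum.map σ id) F = F)
    (hy : ∀ σ : Equiv.Perm (Fin n), rename (Sum.map id σ) F = F)
    (e : Fin m ⊕ Fin n →₀ ℕ) {A B : Multiset ℕ}
    (hA : Finset.univ.val.map (fun i => e (Sum.inl i)) = A)
    (hB : Finset.univ.val.map (fun i => e (Sum.inr i)) = B) :
    cc5 m n F A B = coeff e F := by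
  have h : ∃ e : Fin m ⊕ Fin n →₀ ℕ, Finset.univ.val.map (fun i => e (Sum.inl i)) = A ∧
    Finset.univ.val.map (fun i => e (Sum.inr i)) = B := ⟨e, hA, hB⟩
  rw [cc5, dif_pos h]
  obtain ⟨h1, h2⟩ := h.choose_spec
  set e1 := h.choose
  obtain ⟨σ, hσ⟩ := exists_perm5 _ _ (hA.trans h1.symm)
  obtain ⟨τ, hτ⟩ := exists_perm5 _ _ (hB.trans h2.symm)
  have hinj : Function.Injective (Sum.map σ τ) := Sum.map_injective.2 ⟨σ.injective, τ.injective⟩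
  have hF : rename (Sum.map σ τ) F = F := by
    conv_rhs => rw [← hx σ, ← hy τ]
    rw [rename_rename, Sum.map_comp_map]; rfl
  have he : Finsupp.mapDomain (Sum.map σ τ) e = e1 := by
    ext y
    obtain ⟨x, rfl⟩ : ∃ x, Sum.map σ τ x = y := (Equiv.sumCongr σ τ).surjective y
    rw [Finsupp.mapDomain_apply hinj]
    rcases x with i | j
    · exact (hσ i).symm
    · exact (hτ j).symm
  rw [← coeff_rename_mapDomain _ hinj F e, hF, he]

lemma cc5_card {m n : ℕ} {F : MvPolynomial (Fin m ⊕ Fin n) ℚ} {A B : Multiset ℕ}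
    (h : ¬ (A.card = m ∧ B.card = n)) : cc5 m n F A B = 0 := by
  rw [cc5, dif_neg]
  rintro ⟨e, rfl, rfl⟩
  simp at h

lemma exists_fun5 (A : Multiset ℕ) : ∃ a : Fin A.card → ℕ, (List.ofFn a : Multiset ℕ) = A := by
  induction A using Quotient.inductionOn with
  | _ l => exact ⟨l.get, by simp [List.ofFn_get]⟩

lemma cc5_serre {m n : ℕ} {F : MvPolynomial (Fin m ⊕ Fin n) ℚ}
    (hx : ∀ σ : Equiv.Perm (Fin m), rename (Sum.map σ id) F = F)
    (hy : ∀ σ : Equiv.Perm (Fin n), rename (Sum.map id σ) F = F)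
    (h1 : ∀ (h0 : 0 < m) (hm : 2 ≤ m) (hn : 1 ≤ n),
      rename (fun v : Fin m ⊕ Fin n =>
        if v = Sum.inl ⟨1, hm⟩ ∨ v = Sum.inr ⟨0, hn⟩
        then (Sum.inl (⟨0, h0⟩ : Fin m)) else v) F = 0)
    (h2 : ∀ (h0 : 0 < n) (hm : 1 ≤ m) (hn : 2 ≤ n),
      rename (fun v : Fin m ⊕ Fin n =>
        if v = Sum.inr (⟨0, h0⟩ : Fin n) ∨ v = Sum.inr ⟨1, hn⟩
        then (Sum.inl (⟨0, hm⟩ : Fin m)) else v) F = 0) :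
    Serre5 (cc5 m n F) := by
  constructor
  · intro A B d
    by_cases hc : A.card + 2 = m ∧ B.card + 1 = n
    · obtain ⟨rfl, rfl⟩ := hc
      obtain ⟨a, ha⟩ := exists_fun5 A
      obtain ⟨b, hb⟩ := exists_fun5 B
      have key := coeff_rename5 (Sum.inl ⟨0, by omega⟩) (Sum.inl ⟨1, by omega⟩) (Sum.inr ⟨0, by omega⟩)
        (by simp) (by simp) (by simp)
        (fun i j k => (Finsupp.equivFunOnFinite.symm
          (Sum.elim (Fin.cons i (Fin.cons j a) : Fin (A.card + 2) → ℕ)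
            (Fin.cons k b : Fin (B.card + 1) → ℕ))))
        (fun i j k => rfl) (fun i j k => rfl) (fun i j k => rfl)
        (by
          rintro i j k (v | v) hp hq hr
          · induction v using Fin.cases with
            | zero => exact absurd rfl hp
            | succ v =>
              induction v using Fin.cases with
              | zero => exact absurd rfl hq
              | succ v => rfl
          · induction v using Fin.cases with
            | zero => exact absurd rfl hr
            | succ v => rfl) F d
      rw [h1 (by omega) (by omega) (by omega), coeff_zero] at key
      rw [← key]
      refine Finset.sum_congr rfl fun x _ => ?_
      apply cc5_eq hx hy
      · refine Eq.trans (b := x.1 ::ₘ x.2.1 ::ₘ (List.ofFn a : Multiset ℕ)) ?_ (by rw [ha])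
        simp [Fin.univ_val_map, List.ofFn_cons]
      · refine Eq.trans (b := x.2.2 ::ₘ (List.ofFn b : Multiset ℕ)) ?_ (by rw [hb])
        simp [Fin.univ_val_map, List.ofFn_cons]
    · refine Finset.sum_eq_zero fun x _ => cc5_card ?_
      simpa using hc
  · intro A B d
    by_cases hc : A.card + 1 = m ∧ B.card + 2 = n
    · obtain ⟨rfl, rfl⟩ := hc
      obtain ⟨a, ha⟩ := exists_fun5 A
      obtain ⟨b, hb⟩ := exists_fun5 B
      have key := coeff_rename5 (Sum.inl ⟨0, by omega⟩) (Sum.inr ⟨0, by omega⟩) (Sum.inr ⟨1, by omega⟩)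
        (by simp) (by simp) (by simp)
        (fun i j k => (Finsupp.equivFunOnFinite.symm
          (Sum.elim (Fin.cons i a : Fin (A.card + 1) → ℕ)
            (Fin.cons j (Fin.cons k b) : Fin (B.card + 2) → ℕ))))
        (fun i j k => rfl) (fun i j k => rfl) (fun i j k => rfl)
        (by
          rintro i j k (v | v) hp hq hr
          · induction v using Fin.cases with
            | zero => exact absurd rfl hp
            | succ v => rfl
          · induction v using Fin.cases with
            | zero => exact absurd rfl hq
            | succ v =>
              induction v using Fin.cases with
              | zero => exact absurd rfl hr
              | succ v => rfl) F d
      rw [h2 (by omega) (by omega) (by omega), coeff_zero] at key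
      rw [← key]
      refine Finset.sum_congr rfl fun x _ => ?_
      apply cc5_eq hx hy
      · refine Eq.trans (b := x.1 ::ₘ (List.ofFn a : Multiset ℕ)) ?_ (by rw [ha])
        simp [Fin.univ_val_map, List.ofFn_cons]
      · refine Eq.trans (b := x.2.1 ::ₘ x.2.2 ::ₘ (List.ofFn b : Multiset ℕ)) ?_ (by rw [hb])
        simp [Fin.univ_val_map, List.ofFn_cons]
    · refine Finset.sum_eq_zero fun x _ => cc5_card ?_
      simpa using hc

lemma eval_aeval5 {σ : Type*} (p : σ → ℚ) (φ : σ → MvPolynomial σ ℚ) (G : MvPolynomial σ ℚ) :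
    eval p (aeval φ G) = eval (fun v => eval p (φ v)) G := by
  induction G using MvPolynomial.induction_on with
  | C a => simp
  | add f g hf hg => simp only [map_add, hf, hg]
  | mul_X f i hf => simp only [map_mul, hf]; simp

lemma aeval_ite5 {σ : Type*} (P : σ → Prop) [DecidablePred P] (p : σ) (f : MvPolynomial σ ℚ)
    (h : aeval (fun v => if P v then (X p : MvPolynomial σ ℚ) else X v) f = 0) :
    rename (fun v => if P v then p else v) f = 0 := by
  rw [← h]
  have : rename (fun v => if P v then p else v) =
      aeval (R := ℚ) (fun v => if P v then (X p : MvPolynomial σ ℚ) else X v) := by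
    apply MvPolynomial.algHom_ext
    intro v
    rw [rename_X, aeval_X]
    split_ifs <;> rfl
  rw [this]

lemma multX5 (s t m : ℕ) (hm : s + t + 2 ≤ m) (a : Fin m → ℕ)
    (ha : ∀ i : Fin m, (i : ℕ) < s + t + 2 → a i = min (i : ℕ) s) :
    ∃ A, Finset.univ.val.map a = Multiset.range s + Multiset.replicate (t+2) s + A := by
  obtain ⟨r, rfl⟩ : ∃ r, m = s + (t + 2) + r := ⟨m - (s + t + 2), by omega⟩
  rw [Fin.univ_val_map, List.ofFn_add, List.ofFn_add]
  refine ⟨(List.ofFn fun j => a (Fin.natAdd (s + (t + 2)) j) : List ℕ), ?_⟩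
  rw [← Multiset.coe_add, ← Multiset.coe_add]
  congr 2
  · rw [Multiset.range]
    congr 1
    refine List.ext_getElem (by simp) fun i h1 h2 => ?_
    simp at h1 h2 ⊢
    rw [ha] <;> simp <;> omega
  · rw [← Multiset.coe_replicate]
    congr 1
    refine List.ext_getElem (by simp) fun i h1 h2 => ?_
    rw [List.length_replicate] at h2
    rw [List.getElem_ofFn, List.getElem_replicate]
    rw [ha] <;> simp <;> omega

lemma multY5 (s t n : ℕ) (hn : s + 1 ≤ n) (b : Fin n → ℕ)
    (hb : ∀ i : Fin n, (i : ℕ) < s → b i = i) (hb' : ∀ i : Fin n, (i : ℕ) = s → b i = s + t) :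
    ∃ B, Finset.univ.val.map b = (s + t) ::ₘ (Multiset.range s + B) := by
  obtain ⟨r, rfl⟩ : ∃ r, n = s + 1 + r := ⟨n - (s + 1), by omega⟩
  rw [Fin.univ_val_map, List.ofFn_add, List.ofFn_add]
  refine ⟨(List.ofFn fun j => b (Fin.natAdd (s + 1) j) : List ℕ), ?_⟩
  rw [← Multiset.coe_add, ← Multiset.coe_add, ← Multiset.cons_add]
  congr 1
  rw [add_comm, ← Multiset.singleton_add]
  congr 1
  · simp
    apply hb'; simp
  · rw [Multiset.range]
    congr 1
    refine List.ext_getElem (by simp) fun i h1 h2 => ?_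
    simp at h1 h2 ⊢
    rw [hb] <;> simp; omega

/-- for a polynomial `f` symmetric separately in `x₁,…,x_m` and
`y₁,…,y_n` satisfying the Serre relations, the identity
`[0,1,2,…,s,s,s^t; 0,1,2,…,s−1,s+t] f = 0` holds: differentiate by
`(∂/∂x_i)^{min(i−1,s)}` for the first `s+t+2` `x`-variables, by `(∂/∂y_j)^{j−1}`
for `j = 1,…,s` and `(∂/∂y_{s+1})^{s+t}`, then set those `x` and `y` variables
equal to a common value `z` (realized as the variable `x₁`); the result is `0`. -/
theorem stmt5 (m n : ℕ) (f : MvPolynomial (Fin m ⊕ Fin n) ℚ)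
    (hx : ∀ σ : Equiv.Perm (Fin m), rename (Sum.map σ id) f = f)
    (hy : ∀ σ : Equiv.Perm (Fin n), rename (Sum.map id σ) f = f)
    (hserre1 : ∀ (hm : 2 ≤ m) (hn : 1 ≤ n),
      aeval (fun v : Fin m ⊕ Fin n =>
        if v = Sum.inl ⟨1, hm⟩ ∨ v = Sum.inr ⟨0, hn⟩
        then (X (Sum.inl (⟨0, by omega⟩ : Fin m)) : MvPolynomial (Fin m ⊕ Fin n) ℚ)
        else X v) f = 0)
    (hserre2 : ∀ (hm : 1 ≤ m) (hn : 2 ≤ n),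
      aeval (fun v : Fin m ⊕ Fin n =>
        if v = Sum.inr (⟨0, by omega⟩ : Fin n) ∨ v = Sum.inr ⟨1, hn⟩
        then (X (Sum.inl (⟨0, hm⟩ : Fin m)) : MvPolynomial (Fin m ⊕ Fin n) ℚ)
        else X v) f = 0)
    (s t : ℕ) (hm : s + t + 2 ≤ m) (hn : s + 1 ≤ n) :
    aeval (Sum.elim
        (fun i : Fin m => if (i : ℕ) < s + t + 2
          then (X (Sum.inl (⟨0, by omega⟩ : Fin m)) : MvPolynomial (Fin m ⊕ Fin n) ℚ)
          else X (Sum.inl i))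
        (fun j : Fin n => if (j : ℕ) < s + 1
          then (X (Sum.inl (⟨0, by omega⟩ : Fin m)) : MvPolynomial (Fin m ⊕ Fin n) ℚ)
          else X (Sum.inr j)))
      (mderivY m n (fun j => if (j : ℕ) < s then (j : ℕ) else if (j : ℕ) = s then s + t else 0)
        (mderivX m n (fun i => if (i : ℕ) < s + t + 2 then min (i : ℕ) s else 0) f)) = 0 := by
  classical
  refine MvPolynomial.funext fun p => ?_
  rw [eval_aeval5, map_zero]
  set z : ℚ := p (Sum.inl ⟨0, by omega⟩) with hz
  rw [eval_shift5 z]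
  set dX : Fin m → ℕ := fun i => if (i : ℕ) < s + t + 2 then min (i : ℕ) s else 0 with hdX
  set dY : Fin n → ℕ := fun j => if (j : ℕ) < s then (j : ℕ) else if (j : ℕ) = s then s + t else 0 with hdY
  have hD : mderivY m n dY (mderivX m n dX f) =
      ((List.finRange m).map Sum.inl ++ (List.finRange n).map Sum.inr).foldl
        (fun g v => (⇑(pderiv v))^[Sum.elim dX dY v] g) f := by
    rw [List.foldl_append, List.foldl_map, List.foldl_map]; rfl
  rw [hD, shift_foldl5]
  have hxF : ∀ σ : Equiv.Perm (Fin m), rename (Sum.map σ id) (shift5 z f) = shift5 z f := by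
    intro σ; rw [← shift_rename5, hx]
  have hyF : ∀ σ : Equiv.Perm (Fin n), rename (Sum.map id σ) (shift5 z f) = shift5 z f := by
    intro σ; rw [← shift_rename5, hy]
  have hS : Serre5 (cc5 m n (shift5 z f)) := by
    apply cc5_serre hxF hyF
    · intro _ hm hn
      rw [← shift_rename5, aeval_ite5 _ _ _ (hserre1 hm hn), map_zero]
    · intro _ hm hn
      rw [← shift_rename5, aeval_ite5 _ _ _ (hserre2 hm hn), map_zero]
  apply eval_foldl5 (P := Sum.elim (fun i : Fin m => (i : ℕ) < s + t + 2) (fun j : Fin n => (j : ℕ) < s + 1))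
  · rw [List.nodup_append]
    refine ⟨(List.nodup_finRange m).map Sum.inl_injective, (List.nodup_finRange n).map Sum.inr_injective, ?_⟩
    simp
  · rintro (v | v) <;> simp
  · rintro (v | v) hv
    · simp only [Sum.elim_inl] at hv ⊢
      rw [if_pos hv]; simp [hz]
    · simp only [Sum.elim_inr] at hv ⊢
      rw [if_pos hv]; simp [hz]
  · intro e he
    obtain ⟨A, hA⟩ := multX5 s t m hm (fun i => e (Sum.inl i)) (fun i hi => by
      rw [he (Sum.inl i) hi]; simp [hdX, hi])
    obtain ⟨B, hB⟩ := multY5 s t n hn (fun i => e (Sum.inr i))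
      (fun i hi => by rw [he (Sum.inr i) (by simp; omega)]; simp [hdY, hi])
      (fun i hi => by rw [he (Sum.inr i) (by simp; omega)]; simp [hdY, hi])
    rw [← cc5_eq hxF hyF e hA hB]
    exact Serre5.main s t hS A B
end

section
/- Let f be a polynomial symmetric separately in x_1,…,x_m and y_1,…,y_n satisfying the Serre relations, and suppose additionally that [0,1,…,l_3; 0,1,…,l_3]f vanishes at z = 0 (the h_1^{l_3+1} = 0 condition). Then for every s ≥ l_3 (with m ≥ s+1, n ≥ l_3+1), the quantity [0^{s+1}; s^{l_3+1}]f vanishes at z = 0; that is, ∏_{j=1}^{l_3+1}(∂/∂y_j)^s f evaluated at x_1 = ⋯ = x_{s+1} = y_1 = ⋯ = y_{l_3+1} = 0 is zero. -/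
open MvPolynomial

set_option linter.unusedSectionVars false

section Aux
variable {σ : Type*} [DecidableEq σ]

noncomputable def sS (q : σ) (t : MvPolynomial σ ℚ) : MvPolynomial σ ℚ →ₐ[ℚ] MvPolynomial σ ℚ :=
  aeval (fun v => if v = q then t else X v)

theorem sS_X (q : σ) (t : MvPolynomial σ ℚ) (v : σ) :
    sS q t (X v) = if v = q then t else X v := by simp [sS]

open Classical in
noncomputable def phiW (L : Set σ) :
    MvPolynomial σ ℚ →ₐ[ℚ] Polynomial (MvPolynomial σ ℚ) :=
  aeval (fun v => if v ∈ L then Polynomial.X * Polynomial.C (X v) else Polynomial.C (X v))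

theorem phiW_eval (L : Set σ) (f : MvPolynomial σ ℚ) : (phiW L f).eval 1 = f := by
  have : ((Polynomial.aeval (R := MvPolynomial σ ℚ) (1 : MvPolynomial σ ℚ)).restrictScalars ℚ).comp
      (phiW L) = AlgHom.id ℚ _ := by
    apply MvPolynomial.algHom_ext
    intro v
    simp only [phiW, AlgHom.comp_apply, aeval_X]
    split_ifs <;> simp
  have h := DFunLike.congr_fun this f
  simpa [Polynomial.aeval_def, Polynomial.eval₂_eq_eval_map] using h

noncomputable def wD (L : Set σ) (f : MvPolynomial σ ℚ) : ℕ := (phiW L f).natDegree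

theorem phiW_ne {L : Set σ} {f : MvPolynomial σ ℚ} (h : f ≠ 0) : phiW L f ≠ 0 := by
  intro h0; apply h; rw [← phiW_eval L f, h0]; simp

theorem wD_mul {L : Set σ} {f g : MvPolynomial σ ℚ} (hf : f ≠ 0) (hg : g ≠ 0) :
    wD L (f * g) = wD L f + wD L g := by
  unfold wD; rw [map_mul, Polynomial.natDegree_mul (phiW_ne hf) (phiW_ne hg)]

theorem wD_prod {L : Set σ} {ι : Type*} (s : Finset ι) (F : ι → MvPolynomial σ ℚ)
    (h : ∀ i ∈ s, F i ≠ 0) (h1 : ∀ i ∈ s, wD L (F i) = 1) : wD L (∏ i ∈ s, F i) = s.card := by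
  rw [wD, map_prod, Polynomial.natDegree_prod _ _ (fun i hi => phiW_ne (h i hi))]
  exact (Finset.sum_congr rfl h1).trans (by simp)

theorem X_sub_ne {p q : σ} (h : p ≠ q) : (X p - X q : MvPolynomial σ ℚ) ≠ 0 := by
  rw [sub_ne_zero]; intro h'; exact h (X_injective h')

theorem wD_X_sub {L : Set σ} {p q : σ} (h : p ≠ q) (hp : p ∈ L) (hq : q ∈ L) :
    wD L (X p - X q) = 1 := by
  have : phiW L (X p - X q) = Polynomial.C (X p - X q) * Polynomial.X := by
    simp [phiW, hp, hq]; ring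
  rw [wD, this, Polynomial.natDegree_C_mul_X _ (X_sub_ne h)]

theorem wD_X {L : Set σ} {p : σ} (hp : p ∈ L) :
    wD L (X p) = 1 := by
  have : phiW L (X p) = Polynomial.C (X p) * Polynomial.X := by
    simp [phiW, hp]
  rw [wD, this, Polynomial.natDegree_C_mul_X _ (X_ne_zero p)]

theorem phiW_sS {L : Set σ} {p q : σ} (hp : p ∈ L) (hq : q ∈ L) (f : MvPolynomial σ ℚ) :
    phiW L (sS q (X p) f) = (phiW L f).map (sS q (X p)).toRingHom := by
  have : (phiW L).comp (sS q (X p)) = (Polynomial.mapAlgHom (sS q (X p))).comp (phiW L) := by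
    apply MvPolynomial.algHom_ext
    intro v
    simp only [phiW, AlgHom.comp_apply, aeval_X, sS_X]
    by_cases hv : v = q
    · subst hv; simp [hp, hq, sS_X]
    · by_cases hL : v ∈ L <;> simp [hv, hL, sS_X]
  exact DFunLike.congr_fun this f

theorem phiW_sS0 {L : Set σ} {q : σ} (f : MvPolynomial σ ℚ) :
    phiW L (sS q 0 f) = (phiW L f).map (sS q 0).toRingHom := by
  have : (phiW L).comp (sS q 0) = (Polynomial.mapAlgHom (sS q 0)).comp (phiW L) := by
    apply MvPolynomial.algHom_ext
    intro v
    simp only [phiW, AlgHom.comp_apply, aeval_X, sS_X]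
    by_cases hv : v = q
    · subst hv; by_cases hL : v ∈ L <;> simp [hL, sS_X]
    · by_cases hL : v ∈ L <;> simp [hv, hL, sS_X]
  exact DFunLike.congr_fun this f

theorem wD_sS {L : Set σ} {p q : σ} (hp : p ∈ L) (hq : q ∈ L) (f : MvPolynomial σ ℚ) :
    wD L (sS q (X p) f) ≤ wD L f := by
  unfold wD; rw [phiW_sS hp hq]; exact Polynomial.natDegree_map_le

theorem wD_sS0 {L : Set σ} {q : σ} (f : MvPolynomial σ ℚ) :
    wD L (sS q 0 f) ≤ wD L f := by
  unfold wD; rw [phiW_sS0]; exact Polynomial.natDegree_map_le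

theorem sS_dvd (q : σ) (t : MvPolynomial σ ℚ) (f : MvPolynomial σ ℚ) (h : sS q t f = 0) :
    (t - X q) ∣ f := by
  rw [← Ideal.mem_span_singleton, ← Ideal.Quotient.eq_zero_iff_mem]
  have : (Ideal.Quotient.mkₐ ℚ (Ideal.span {t - X q})).comp (sS q t) =
      Ideal.Quotient.mkₐ ℚ (Ideal.span {t - X q}) := by
    apply MvPolynomial.algHom_ext
    intro v
    simp only [AlgHom.comp_apply, sS_X]
    split_ifs with hv
    · subst hv
      simp only [Ideal.Quotient.mkₐ_eq_mk]
      rw [Ideal.Quotient.eq]; exact Ideal.mem_span_singleton_self _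
    · rfl
  have h2 := DFunLike.congr_fun this f
  simp only [AlgHom.comp_apply, h, map_zero, Ideal.Quotient.mkₐ_eq_mk] at h2
  exact h2.symm

theorem prod_dvd_aux (T : Finset (σ × σ)) (f : MvPolynomial σ ℚ)
    (h0 : ∀ a ∈ T, sS a.2 (X a.1) f = 0)
    (h1 : ∀ a ∈ T, ∀ b ∈ T, a ≠ b → sS a.2 (X a.1) (X b.1 - X b.2) ≠ 0) :
    ∃ g, f = (∏ a ∈ T, (X a.1 - X a.2)) * g := by
  induction T using Finset.induction_on with
  | empty => exact ⟨f, by simp⟩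
  | insert a T ha ih =>
    obtain ⟨g, hg⟩ := ih (fun b hb => h0 b (by simp [hb]))
      (fun b hb c hc => h1 b (by simp [hb]) c (by simp [hc]))
    have hz := h0 a (by simp)
    rw [hg, map_mul, map_prod, mul_eq_zero, Finset.prod_eq_zero_iff] at hz
    rcases hz with ⟨b, hb, hz⟩ | hz
    · exact absurd hz (h1 a (by simp) b (by simp [hb]) (by rintro rfl; exact ha hb))
    · obtain ⟨k, hk⟩ := sS_dvd _ _ _ hz
      exact ⟨k, by rw [Finset.prod_insert ha, hg, hk]; ring⟩

def Serre (A B : Finset σ) (f : MvPolynomial σ ℚ) : Prop :=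
  ∀ p ∈ A, ∀ r ∈ B, ∀ q ∈ A ∪ B, q ≠ p → q ≠ r → sS q (X p) (sS r (X p) f) = 0

theorem sS_comm {p q r s : σ} (h1 : p ≠ r) (h2 : p ≠ s) (h3 : q ≠ r) (f : MvPolynomial σ ℚ) :
    sS q (X p) (sS r (X s) f) = if s = q then sS r (X p) (sS q (X p) f)
      else sS r (X s) (sS q (X p) f) := by
  have : (sS q (X p)).comp (sS r (X s)) = if s = q then (sS r (X p)).comp (sS q (X p))
      else (sS r (X s)).comp (sS q (X p)) := by
    apply MvPolynomial.algHom_ext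
    intro v
    by_cases hv : v = q <;> by_cases hv' : v = r <;> by_cases hs : s = q <;>
      simp_all [sS_X]
  have h := DFunLike.congr_fun this f
  split_ifs at h ⊢ <;> exact h

theorem sS_comm0 {p q r : σ} (h1 : p ≠ r) (h3 : q ≠ r) (f : MvPolynomial σ ℚ) :
    sS q (X p) (sS r 0 f) = sS r 0 (sS q (X p) f) := by
  have : (sS q (X p)).comp (sS r 0) = (sS r 0).comp (sS q (X p)) := by
    apply MvPolynomial.algHom_ext
    intro v
    by_cases hv : v = q <;> by_cases hv' : v = r <;>
      simp_all [sS_X]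
  exact DFunLike.congr_fun this f

/-- The common first step. -/
theorem step (A B : Finset σ) (hAB : Disjoint A B) (f : MvPolynomial σ ℚ)
    (hS : Serre A B f) (p r : σ) (hp : p ∈ A) (hr : r ∈ B) :
    ∃ g, sS r (X p) f = (∏ v ∈ A.erase p ∪ B.erase r, (X p - X v)) * g ∧
      Serre (A.erase p) (B.erase r) g ∧ sS r (X p) g = g := by
  have hpr : p ≠ r := fun h => (Finset.disjoint_left.1 hAB hp) (h ▸ hr)
  have hV : ∀ v ∈ A.erase p ∪ B.erase r, v ≠ p ∧ v ≠ r ∧ v ∈ A ∪ B := by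
    intro v hv
    have hpB := Finset.disjoint_left.1 hAB hp
    have hrA := Finset.disjoint_right.1 hAB hr
    simp only [Finset.mem_union, Finset.mem_erase] at hv ⊢
    refine ⟨?_, ?_, by tauto⟩
    · rintro rfl; tauto
    · rintro rfl; tauto
  obtain ⟨g, hg⟩ := prod_dvd_aux ((A.erase p ∪ B.erase r).image (fun v => (p, v)))
    (sS r (X p) f) (by
      intro a ha
      obtain ⟨v, hv, rfl⟩ := Finset.mem_image.1 ha
      obtain ⟨h1, h2, h3⟩ := hV v hv
      exact hS p hp r hr v h3 h1 h2) (by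
      intro a ha b hb hab
      obtain ⟨v, hv, rfl⟩ := Finset.mem_image.1 ha
      obtain ⟨w, hw, rfl⟩ := Finset.mem_image.1 hb
      have hvw : w ≠ v := by rintro rfl; exact hab rfl
      have := (hV w hw).1
      have := (hV v hv).1
      simp only [map_sub, sS_X, if_neg hvw, if_neg this.symm]
      exact X_sub_ne (hV w hw).1.symm)
  rw [Finset.prod_image (by intro a _ b _ h; exact (Prod.ext_iff.1 h).2)] at hg
  have hne : (∏ v ∈ A.erase p ∪ B.erase r, (X p - X v : MvPolynomial σ ℚ)) ≠ 0 :=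
    Finset.prod_ne_zero_iff.2 fun v hv => X_sub_ne (hV v hv).1.symm
  refine ⟨g, hg, ?_, ?_⟩
  · intro p' hp' r' hr' q hq hqp hqr
    obtain ⟨a1, a2, a3⟩ := hV p' (Finset.mem_union_left _ hp')
    obtain ⟨b1, b2, b3⟩ := hV r' (Finset.mem_union_right _ hr')
    obtain ⟨c1, c2, c3⟩ := hV q hq
    have h0 := hS p' (Finset.mem_of_mem_erase hp') r' (Finset.mem_of_mem_erase hr') q c3 hqp hqr
    have h1 : sS q (X p') (sS r' (X p') (sS r (X p) f)) = 0 := by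
      rw [sS_comm a2 a1 b2, if_neg b1.symm, sS_comm a2 a1 c2, if_neg c1.symm, h0, map_zero]
    rw [hg, map_mul, map_mul, mul_eq_zero] at h1
    refine h1.resolve_left ?_
    rw [map_prod, map_prod]
    refine Finset.prod_ne_zero_iff.2 ?_
    intro v hv
    obtain ⟨d1, d2, d3⟩ := hV v hv
    simp only [map_sub, sS_X, if_neg b1.symm, if_neg c1.symm]
    split_ifs
    · simp only [sS_X, if_neg hqp.symm]; exact X_sub_ne a1.symm
    · simp only [sS_X]; split_ifs
      · exact X_sub_ne a1.symm
      · exact X_sub_ne d1.symm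
  · have h2 : sS r (X p) (sS r (X p) f) = sS r (X p) f := by
      have : (sS r (X p)).comp (sS r (X p)) = sS r (X p) := by
        apply MvPolynomial.algHom_ext
        intro v
        by_cases hv : v = r <;> simp_all [sS_X]
      exact DFunLike.congr_fun this f
    rw [hg, map_mul, map_prod] at h2
    rw [Finset.prod_congr rfl (g := fun v => (X p - X v : MvPolynomial σ ℚ)) (by
      intro v hv
      simp only [map_sub, sS_X, if_neg hpr, if_neg (hV v hv).2.1])] at h2
    exact mul_left_cancel₀ hne h2

theorem finish (L : Set σ) (A B : Finset σ) (hAB : Disjoint A B) (hA : ↑A ⊆ L) (hB : ↑B ⊆ L)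
    (f : MvPolynomial σ ℚ) (h : ∀ p ∈ A, ∀ r ∈ B, sS r (X p) f = 0)
    (hd : wD L f < A.card * B.card) : f = 0 := by
  by_contra hf
  have hne : ∀ p ∈ A, ∀ r ∈ B, p ≠ r := fun p hp r hr h =>
    (Finset.disjoint_left.1 hAB hp) (h ▸ hr)
  obtain ⟨g, hg⟩ := prod_dvd_aux (A ×ˢ B) f (by
      intro a ha
      rw [Finset.mem_product] at ha
      exact h _ ha.1 _ ha.2) (by
      rintro ⟨p, r⟩ ha ⟨p', r'⟩ hb hab
      rw [Finset.mem_product] at ha hb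
      simp only [map_sub, sS_X, if_neg (hne _ hb.1 _ ha.2)]
      split_ifs with hrr
      · apply X_sub_ne; rintro rfl; exact hab (by rw [hrr])
      · exact X_sub_ne (hne _ hb.1 _ hb.2))
  have hg0 : g ≠ 0 := by rintro rfl; exact hf (by rw [hg, mul_zero])
  have hfac : ∀ a ∈ A ×ˢ B, (X a.1 - X a.2 : MvPolynomial σ ℚ) ≠ 0 := by
    intro a ha
    rw [Finset.mem_product] at ha
    exact X_sub_ne (hne _ ha.1 _ ha.2)
  rw [hg, wD_mul (Finset.prod_ne_zero_iff.2 hfac) hg0, wD_prod _ _ hfac, Finset.card_product] at hd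
  · omega
  · intro a ha
    rw [Finset.mem_product] at ha
    exact wD_X_sub (hne _ ha.1 _ ha.2) (hA ha.1) (hB ha.2)

theorem card_aux (A B : Finset σ) (hAB : Disjoint A B) (p r : σ) (hp : p ∈ A) (hr : r ∈ B) :
    ∃ a b, A.card = a + 1 ∧ B.card = b + 1 ∧ (A.erase p).card = a ∧ (B.erase r).card = b ∧
     (A.erase p ∪ B.erase r).card = a + b := by
  have h1 := Finset.card_erase_add_one hp
  have h2 := Finset.card_erase_add_one hr
  refine ⟨_, _, h1.symm, h2.symm, rfl, rfl, ?_⟩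
  exact Finset.card_union_of_disjoint (hAB.mono (Finset.erase_subset _ _) (Finset.erase_subset _ _))

theorem wD_step (L : Set σ) (A B : Finset σ) (hAB : Disjoint A B) (hA : ↑A ⊆ L) (hB : ↑B ⊆ L)
    (f g : MvPolynomial σ ℚ) (p r : σ) (hp : p ∈ A) (hr : r ∈ B) (hg0 : g ≠ 0)
    (hg : sS r (X p) f = (∏ v ∈ A.erase p ∪ B.erase r, (X p - X v)) * g) :
    (A.erase p ∪ B.erase r).card + wD L g ≤ wD L f := by
  have hV : ∀ v ∈ A.erase p ∪ B.erase r, p ≠ v ∧ v ∈ L := by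
    intro v hv
    have hpB := Finset.disjoint_left.1 hAB hp
    simp only [Finset.mem_union, Finset.mem_erase] at hv
    refine ⟨?_, ?_⟩
    · rintro rfl; tauto
    · rcases hv with hv | hv
      · exact hA hv.2
      · exact hB hv.2
  have h := wD_sS (hA hp) (hB hr) f
  rw [hg, wD_mul (Finset.prod_ne_zero_iff.2 fun v hv => X_sub_ne (hV v hv).1) hg0,
    wD_prod _ _ (fun v hv => X_sub_ne (hV v hv).1)
      (fun v hv => wD_X_sub (hV v hv).1 (hA hp) (hV v hv).2)] at h
  exact h

theorem claimA (L : Set σ) (b : ℕ) : ∀ (A B : Finset σ) (_ : B.card = b) (_ : Disjoint A B)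
    (_ : ↑A ⊆ L) (_ : ↑B ⊆ L)
    (f : MvPolynomial σ ℚ) (_ : Serre A B f) (_ : wD L f + B.card < A.card * B.card), f = 0 := by
  induction b with
  | zero => intro A B hb _ _ _ f _ hd; simp [hb] at hd
  | succ b ih =>
    intro A B hb hAB hA hB f hS hd
    refine finish L A B hAB hA hB f ?_ (by omega)
    intro p hp r hr
    obtain ⟨g, hg, hgS, -⟩ := step A B hAB f hS p r hp hr
    rw [hg]
    by_cases hg0 : g = 0
    · rw [hg0, mul_zero]
    exfalso; apply hg0
    have hw := wD_step L A B hAB hA hB f g p r hp hr hg0 hg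
    obtain ⟨a', b', h1, h2, h3, h4, h5⟩ := card_aux A B hAB p r hp hr
    refine ih (A.erase p) (B.erase r) (by omega)
      (hAB.mono (Finset.erase_subset _ _) (Finset.erase_subset _ _))
      (fun x hx => hA (Finset.mem_of_mem_erase hx))
      (fun x hx => hB (Finset.mem_of_mem_erase hx)) g hgS ?_
    rw [h3, h4]; rw [h1, h2] at hd; rw [h5] at hw
    nlinarith

theorem coeff_zero_sub (Z : σ → Prop) [DecidablePred Z] (f : MvPolynomial σ ℚ) (e : σ →₀ ℕ) 
    [Decidable (∀ v, Z v → e v = 0)] :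
    coeff e (aeval (fun v => if Z v then (0 : MvPolynomial σ ℚ) else X v) f) =
      if ∀ v, Z v → e v = 0 then coeff e f else 0 := by
  induction f using MvPolynomial.induction_on' with
  | add p q hp hq => rw [map_add, coeff_add, coeff_add, hp, hq]; split_ifs <;> simp
  | monomial u a =>
    rw [aeval_monomial]
    by_cases hu : ∀ v, Z v → u v = 0
    · have : (u.prod fun i k => (if Z i then (0 : MvPolynomial σ ℚ) else X i) ^ k)
          = u.prod fun i k => (X i : MvPolynomial σ ℚ) ^ k := by
        apply Finsupp.prod_congr
        intro v hv
        have : ¬ Z v := fun h => (Finsupp.mem_support_iff.1 hv) (hu v h)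
        simp [this]
      rw [this, algebraMap_eq, ← monomial_eq, coeff_monomial]
      split_ifs with h1 h2 h2
      · rfl
      · subst h1; exact absurd hu h2
      · rfl
      · rfl
    · push Not at hu
      obtain ⟨v, hv, hv0⟩ := hu
      rw [Finsupp.prod, Finset.prod_eq_zero (Finsupp.mem_support_iff.2 hv0) (by simp [hv, hv0])]
      rw [mul_zero, coeff_zero, coeff_monomial]
      split_ifs with h1 h2
      · subst h2; exact absurd (h1 v hv) hv0
      · rfl
      · rfl

theorem coeff_sS0 (q : σ) (f : MvPolynomial σ ℚ) (e : σ →₀ ℕ) :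
    coeff e (sS q 0 f) = if e q = 0 then coeff e f else 0 := by
  classical
  rw [sS, coeff_zero_sub (fun v => v = q)]
  simp

def Cond (A B : Finset σ) (f : MvPolynomial σ ℚ) : Prop :=
  ∀ e : σ →₀ ℕ, Finset.range B.card ⊆ A.image e → Finset.range B.card ⊆ B.image e → coeff e f = 0

theorem cond_step (A B : Finset σ) (hAB : Disjoint A B)
    (f g : MvPolynomial σ ℚ) (p r : σ) (hp : p ∈ A) (hr : r ∈ B)
    (hg : sS r (X p) f = (∏ v ∈ A.erase p ∪ B.erase r, (X p - X v)) * g) (hC : Cond A B f) :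
    Cond (A.erase p) (B.erase r) (sS r 0 (sS p 0 g)) := by
  intro e he1 he2
  have hpr : p ≠ r := fun h => (Finset.disjoint_left.1 hAB hp) (h ▸ hr)
  have hV : ∀ v ∈ A.erase p ∪ B.erase r, v ≠ p ∧ v ≠ r := by
    intro v hv
    have hpB := Finset.disjoint_left.1 hAB hp
    have hrA := Finset.disjoint_right.1 hAB hr
    simp only [Finset.mem_union, Finset.mem_erase] at hv ⊢
    refine ⟨?_, ?_⟩
    · rintro rfl; tauto
    · rintro rfl; tauto
  have h1 : sS r 0 (sS p 0 (sS r (X p) f)) = sS r 0 (sS p 0 f) := by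
    have : (sS r 0).comp ((sS p 0).comp (sS r (X p))) = (sS r 0).comp (sS p 0) := by
      apply MvPolynomial.algHom_ext
      intro v
      by_cases hv : v = r <;> by_cases hv' : v = p <;> simp_all [sS_X]
    exact DFunLike.congr_fun this f
  set V := A.erase p ∪ B.erase r with hVdef
  set m : σ →₀ ℕ := ∑ v ∈ V, Finsupp.single v 1 with hm
  have hmv : ∀ v, m v = if v ∈ V then 1 else 0 := by
    intro v; simp [hm, Finsupp.finsetSum_apply, Finsupp.single_apply]
  have h2 : sS r 0 (sS p 0 (∏ v ∈ V, (X p - X v : MvPolynomial σ ℚ))) =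
      monomial m ((-1 : ℚ) ^ V.card) := by
    rw [map_prod, map_prod]
    rw [Finset.prod_congr rfl (g := fun v => (monomial (Finsupp.single v 1) (-1 : ℚ)))]
    · rw [hm]
      clear_value V
      clear * -
      induction V using Finset.induction_on with
      | empty => simp
      | insert a V ha ih =>
        rw [Finset.prod_insert ha, ih, monomial_mul, Finset.sum_insert ha,
          Finset.card_insert_of_notMem ha, pow_succ']
    · intro v hv
      rw [map_sub, sS_X, sS_X, if_neg (hV v hv).1, if_pos rfl, map_sub, sS_X, if_neg (hV v hv).2,
        map_zero, zero_sub, X, ← map_neg]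
  rw [hg, map_mul, map_mul, h2] at h1
  have h3 := congrArg (coeff (m + e)) h1
  rw [coeff_monomial_mul] at h3
  by_cases hep : e p = 0
  swap
  · rw [coeff_sS0, coeff_sS0, if_neg hep, ite_self]
  by_cases her : e r = 0
  swap
  · rw [coeff_sS0, if_neg her]
  have hp0 : (m + e) p = 0 := by
    rw [Finsupp.add_apply, hmv, if_neg (fun h => (hV p h).1 rfl), hep]
  have hr0 : (m + e) r = 0 := by
    rw [Finsupp.add_apply, hmv, if_neg (fun h => (hV r h).2 rfl), her]
  have h4 : coeff (m + e) f = 0 := by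
    have hc := Finset.card_erase_add_one hr
    apply hC
    · intro k hk
      rcases k with _ | k
      · exact Finset.mem_image.2 ⟨p, hp, hp0⟩
      · have hk' : k ∈ Finset.range (B.erase r).card := by
          simp only [Finset.mem_range] at hk ⊢; omega
        obtain ⟨v, hv, hvk⟩ := Finset.mem_image.1 (he1 hk')
        refine Finset.mem_image.2 ⟨v, Finset.mem_of_mem_erase hv, ?_⟩
        rw [Finsupp.add_apply, hmv, if_pos (Finset.mem_union_left _ hv), hvk, add_comm]
    · intro k hk
      rcases k with _ | k
      · exact Finset.mem_image.2 ⟨r, hr, hr0⟩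
      · have hk' : k ∈ Finset.range (B.erase r).card := by
          simp only [Finset.mem_range] at hk ⊢; omega
        obtain ⟨v, hv, hvk⟩ := Finset.mem_image.1 (he2 hk')
        refine Finset.mem_image.2 ⟨v, Finset.mem_of_mem_erase hv, ?_⟩
        rw [Finsupp.add_apply, hmv, if_pos (Finset.mem_union_right _ hv), hvk, add_comm]
  rw [coeff_sS0 r (sS p 0 f), coeff_sS0 p f, if_pos hr0, if_pos hp0, h4, mul_eq_zero] at h3
  exact h3.resolve_left (by simp)

theorem claimB (L : Set σ) (b : ℕ) : ∀ (A B : Finset σ) (_ : B.card = b) (_ : Disjoint A B)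
    (_ : ↑A ⊆ L) (_ : ↑B ⊆ L)
    (f : MvPolynomial σ ℚ) (_ : Serre A B f) (_ : Cond A B f)
    (_ : wD L f + B.card ≤ A.card * B.card), f = 0 := by
  induction b with
  | zero =>
    intro A B hb _ _ _ f _ hC _
    ext e
    rw [coeff_zero]
    exact hC e (by simp [hb]) (by simp [hb])
  | succ b ih =>
    intro A B hb hAB hA hB f hS hC hd
    refine finish L A B hAB hA hB f ?_ (by omega)
    intro p hp r hr
    have hpr : p ≠ r := fun h => (Finset.disjoint_left.1 hAB hp) (h ▸ hr)
    obtain ⟨g, hg, hgS, hgr⟩ := step A B hAB f hS p r hp hr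
    have hC' := cond_step A B hAB f g p r hp hr hg hC
    rw [hg]
    by_cases hg0 : g = 0
    · rw [hg0, mul_zero]
    exfalso
    have hw := wD_step L A B hAB hA hB f g p r hp hr hg0 hg
    obtain ⟨a', b', h1, h2, h3, h4, h5⟩ := card_aux A B hAB p r hp hr
    have hne : ∀ v, v ∈ A.erase p ∪ B.erase r → v ≠ p ∧ v ≠ r := by
      intro v hv
      have hpB := Finset.disjoint_left.1 hAB hp
      have hrA := Finset.disjoint_right.1 hAB hr
      simp only [Finset.mem_union, Finset.mem_erase] at hv ⊢
      refine ⟨?_, ?_⟩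
      · rintro rfl; tauto
      · rintro rfl; tauto
    have hz : sS r 0 (sS p 0 g) = 0 := by
      refine ih (A.erase p) (B.erase r) (by omega)
        (hAB.mono (Finset.erase_subset _ _) (Finset.erase_subset _ _))
        (fun x hx => hA (Finset.mem_of_mem_erase hx))
        (fun x hx => hB (Finset.mem_of_mem_erase hx)) _ ?_ hC' ?_
      · intro p' hp' r' hr' q hq hqp hqr
        have a := hne p' (Finset.mem_union_left _ hp')
        have b := hne r' (Finset.mem_union_right _ hr')
        have c := hne q hq
        rw [sS_comm0 a.2 b.2, sS_comm0 a.1 b.1, sS_comm0 a.2 c.2, sS_comm0 a.1 c.1,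
          hgS p' hp' r' hr' q hq hqp hqr, map_zero, map_zero]
      · have := (wD_sS0 (L := L) (q := r) (sS p 0 g)).trans (wD_sS0 g)
        rw [h3, h4]; rw [h1, h2] at hd; rw [h5] at hw
        nlinarith
    have hz' : sS p 0 g = 0 := by
      have : (sS p 0).comp (sS r (X p)) = (sS r 0).comp ((sS p 0).comp (sS r (X p))) := by
        apply MvPolynomial.algHom_ext
        intro v
        by_cases hv : v = r <;> by_cases hv' : v = p <;> simp_all [sS_X]
      have h := DFunLike.congr_fun this g
      simp only [AlgHom.comp_apply, hgr, hz] at h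
      exact h
    obtain ⟨k, hk⟩ := sS_dvd _ _ _ hz'
    have hk' : g = X p * (-k) := by rw [hk]; ring
    have hk0 : -k ≠ 0 := by intro h; rw [h, mul_zero] at hk'; exact hg0 hk'
    apply hk0
    have hwk : wD L g = 1 + wD L (-k) := by
      rw [hk', wD_mul (X_ne_zero p) hk0, wD_X (hA hp)]
    refine claimA L b (A.erase p) (B.erase r) (by omega)
      (hAB.mono (Finset.erase_subset _ _) (Finset.erase_subset _ _))
      (fun x hx => hA (Finset.mem_of_mem_erase hx))
      (fun x hx => hB (Finset.mem_of_mem_erase hx)) _ ?_ ?_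
    · intro p' hp' r' hr' q hq hqp hqr
      have b := hne r' (Finset.mem_union_right _ hr')
      have c := hne q hq
      have h := hgS p' hp' r' hr' q hq hqp hqr
      rw [hk', map_mul, map_mul, sS_X, if_neg b.1.symm, sS_X, if_neg c.1.symm, mul_eq_zero] at h
      exact h.resolve_left (X_ne_zero p)
    · rw [h3, h4]; rw [h1, h2] at hd; rw [h5] at hw
      nlinarith

theorem phiW_monomial (L : Set σ) (u : σ →₀ ℕ) (a : ℚ) [DecidablePred (· ∈ L)] :
    phiW L (monomial u a) =
      Polynomial.C (monomial u a) * Polynomial.X ^ (∑ v ∈ u.support with v ∈ L, u v) := by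
  rw [phiW, aeval_monomial, monomial_eq, Finsupp.prod, Finsupp.prod, Finset.sum_filter,
    ← Finset.prod_pow_eq_pow_sum, map_mul, map_prod, mul_assoc, ← Finset.prod_mul_distrib]
  congr 1
  apply Finset.prod_congr rfl
  intro v _
  by_cases h : v ∈ L
  · rw [if_pos h, if_pos h, mul_pow, mul_comm, map_pow]
  · rw [if_neg h, if_neg h, pow_zero, mul_one, map_pow]

theorem coeff_phiW (L : Set σ) (D : ℕ) (e : σ →₀ ℕ) (f : MvPolynomial σ ℚ)
     [DecidablePred (· ∈ L)] :
    coeff e ((phiW L f).coeff D) =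
      if D = (∑ v ∈ e.support with v ∈ L, e v) then coeff e f else 0 := by
  induction f using MvPolynomial.induction_on' with
  | add p q hp hq => rw [map_add, Polynomial.coeff_add, coeff_add, coeff_add, hp, hq]; split_ifs <;> simp
  | monomial u a =>
    rw [phiW_monomial, Polynomial.coeff_C_mul_X_pow]
    by_cases h : u = e
    · subst h; split_ifs <;> simp
    · split_ifs <;> simp [h]

theorem wD_coeff (L : Set σ) (D : ℕ) (f : MvPolynomial σ ℚ) : wD L ((phiW L f).coeff D) ≤ D := by
  classical
  induction f using MvPolynomial.induction_on' with
  | add p q hp hq =>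
    rw [map_add, Polynomial.coeff_add, wD, map_add]
    exact (Polynomial.natDegree_add_le _ _).trans (max_le hp hq)
  | monomial u a =>
    rw [phiW_monomial, Polynomial.coeff_C_mul_X_pow]
    split_ifs with h
    · rw [wD, phiW_monomial, ← h]; exact Polynomial.natDegree_C_mul_X_pow_le _ _
    · simp [wD]

/-- Main abstract result. -/
theorem mainAbs (A B : Finset σ) (hAB : Disjoint A B) (f : MvPolynomial σ ℚ)
    (hS : Serre A B f) (hC : Cond A B f) (e : σ →₀ ℕ) (s : ℕ) (hs : A.card = s + 1)
    (heA : ∀ v ∈ A, e v = 0) (heB : ∀ v ∈ B, e v = s) : coeff e f = 0 := by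
  classical
  have h0 : (phiW (↑(A ∪ B) : Set σ) f).coeff (s * B.card) = 0 := by
    refine claimB (↑(A ∪ B) : Set σ) B.card A B rfl hAB (by simp) (by simp) _ ?_ ?_ ?_
    · intro p hp r hr q hq hqp hqr
      have hpL : p ∈ (↑(A ∪ B) : Set σ) := by simp [hp]
      have hrL : r ∈ (↑(A ∪ B) : Set σ) := by simp [hr]
      have hqL : q ∈ (↑(A ∪ B) : Set σ) := hq
      have h := congrArg (fun g => (phiW (↑(A ∪ B) : Set σ) g).coeff (s * B.card))
        (hS p hp r hr q hq hqp hqr)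
      simp only [phiW_sS hpL hrL, phiW_sS hpL hqL, Polynomial.coeff_map, map_zero,
        Polynomial.coeff_zero] at h
      exact h
    · intro e' h1 h2
      rw [coeff_phiW, hC e' h1 h2, ite_self]
    · have := wD_coeff (↑(A ∪ B) : Set σ) (s * B.card) f
      rw [hs]; nlinarith
  have h1 := coeff_phiW (↑(A ∪ B) : Set σ) (s * B.card) e f
  rw [h0, coeff_zero, if_pos] at h1
  · exact h1.symm
  · have : ∑ v ∈ e.support with v ∈ (↑(A ∪ B) : Set σ), e v = ∑ v ∈ A ∪ B, e v := by
      apply Finset.sum_subset_zero_on_sdiff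
      · intro v; simp
      · intro v; simp; tauto
      · intros; rfl
    rw [this, Finset.sum_union hAB, Finset.sum_eq_zero heA, Finset.sum_congr rfl heB]
    simp [mul_comm]

theorem coeff_pderiv_aux (v : σ) (f : MvPolynomial σ ℚ) (e : σ →₀ ℕ) :
    coeff e (pderiv v f) = (e v + 1) * coeff (e + Finsupp.single v 1) f := by
  induction f using MvPolynomial.induction_on' with
  | add p q hp hq => rw [map_add, coeff_add, coeff_add, hp, hq]; ring
  | monomial u a =>
    rw [pderiv_monomial, coeff_monomial, coeff_monomial]
    by_cases h : u = e + Finsupp.single v 1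
    · subst h; simp [mul_comm]
    · rw [if_neg h, mul_zero]
      split_ifs with h2
      · by_cases hv : u v = 0
        · simp [hv]
        · exfalso; apply h
          rw [← h2, tsub_add_cancel_of_le]
          simpa using Nat.one_le_iff_ne_zero.2 hv
      · rfl

theorem coeff_pderiv_iter (v : σ) (k : ℕ) : ∀ (f : MvPolynomial σ ℚ) (e : σ →₀ ℕ),
    ∃ c : ℚ, c ≠ 0 ∧ coeff e ((⇑(pderiv v))^[k] f) = c * coeff (e + Finsupp.single v k) f := by
  induction k with
  | zero => intro f e; exact ⟨1, by simp, by simp⟩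
  | succ k ih =>
    intro f e
    obtain ⟨c, hc, h⟩ := ih (pderiv v f) e
    refine ⟨c * (((e + Finsupp.single v k) v : ℕ) + 1), mul_ne_zero hc (by positivity), ?_⟩
    rw [Function.iterate_succ_apply, h, coeff_pderiv_aux, add_assoc, ← Finsupp.single_add]
    ring

theorem coeff_fold {ι : Type*} (F : ι → σ) (E : ι → ℕ) (l : List ι) :
    ∀ (f : MvPolynomial σ ℚ) (e : σ →₀ ℕ),
    ∃ c : ℚ, c ≠ 0 ∧ coeff e (l.foldl (fun g j => (⇑(pderiv (F j)))^[E j] g) f) =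
      c * coeff (e + (l.map fun j => Finsupp.single (F j) (E j)).sum) f := by
  induction l with
  | nil => intro f e; exact ⟨1, by simp, by simp⟩
  | cons j l ih =>
    intro f e
    obtain ⟨c, hc, h⟩ := ih ((⇑(pderiv (F j)))^[E j] f) e
    obtain ⟨c', hc', h'⟩ := coeff_pderiv_iter (F j) (E j) f
      (e + (l.map fun j => Finsupp.single (F j) (E j)).sum)
    refine ⟨c * c', mul_ne_zero hc hc', ?_⟩
    rw [List.foldl_cons, h, h', List.map_cons, List.sum_cons, mul_assoc]
    congr 3
    rw [add_assoc, add_comm (Finsupp.single _ _)]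

end Aux

theorem permExt {k m : ℕ} (hk : k ≤ m) (u : Fin k → Fin m) (hu : Function.Injective u) :
    ∃ τ : Equiv.Perm (Fin m), ∀ t : Fin k, τ (Fin.castLE hk t) = u t := by
  classical
  let e : {x // x ∈ Set.range (Fin.castLE hk)} ≃ {x // x ∈ Set.range u} :=
    (Equiv.ofInjective _ (Fin.castLE_injective hk)).symm.trans (Equiv.ofInjective u hu)
  refine ⟨e.extendSubtype, fun t => ?_⟩
  rw [Equiv.extendSubtype_apply_of_mem _ _ ⟨t, rfl⟩]
  have : (⟨Fin.castLE hk t, ⟨t, rfl⟩⟩ : {x // x ∈ Set.range (Fin.castLE hk)}) =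
    Equiv.ofInjective _ (Fin.castLE_injective hk) t := rfl
  change ((Equiv.ofInjective u hu) ((Equiv.ofInjective _ (Fin.castLE_injective hk)).symm
    ⟨Fin.castLE hk t, ⟨t, rfl⟩⟩)).1 = u t
  rw [this, Equiv.symm_apply_apply]; rfl

theorem elim_eq (m n a b : ℕ) : (Sum.elim
        (fun i : Fin m => if (i : ℕ) < a
          then (0 : MvPolynomial (Fin m ⊕ Fin n) ℚ) else X (Sum.inl i))
        (fun j : Fin n => if (j : ℕ) < b
          then (0 : MvPolynomial (Fin m ⊕ Fin n) ℚ) else X (Sum.inr j))) =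
    fun v => if Sum.elim (fun i : Fin m => decide ((i : ℕ) < a))
      (fun j : Fin n => decide ((j : ℕ) < b)) v = true then 0 else X v := by
  funext v
  rcases v with i | j <;> simp

theorem sumY_apply (m n : ℕ) (E : Fin n → ℕ) (v : Fin m ⊕ Fin n) :
    (((List.finRange n).map fun j => Finsupp.single (Sum.inr j : Fin m ⊕ Fin n) (E j)).sum) v =
      Sum.elim (fun _ => 0) E v := by
  rw [← Fin.sum_univ_def, Finsupp.finsetSum_apply]
  rcases v with i | j <;> simp [Finsupp.single_apply]

theorem sumX_apply (m n : ℕ) (E : Fin m → ℕ) (v : Fin m ⊕ Fin n) :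
    (((List.finRange m).map fun j => Finsupp.single (Sum.inl j : Fin m ⊕ Fin n) (E j)).sum) v =
      Sum.elim E (fun _ => 0) v := by
  rw [← Fin.sum_univ_def, Finsupp.finsetSum_apply]
  rcases v with i | j <;> simp [Finsupp.single_apply]

theorem serre_aux {α β : Type*} [DecidableEq α] [DecidableEq β]
    (f : MvPolynomial (α ⊕ β) ℚ) (φ : Equiv.Perm (α ⊕ β)) (hφ : rename φ f = f)
    (p q r : α ⊕ β) (hpq : p ≠ q)
    (h : aeval (fun v => if v = q ∨ v = r then (X p : MvPolynomial (α ⊕ β) ℚ) else X v) f = 0) :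
    sS (φ q) (X (φ p)) (sS (φ r) (X (φ p)) f) = 0 := by
  have h1 : ((sS (φ q) (X (φ p))).comp (sS (φ r) (X (φ p)))).comp (rename φ) =
      (rename φ).comp (aeval (fun v => if v = q ∨ v = r then
        (X p : MvPolynomial (α ⊕ β) ℚ) else X v)) := by
    apply MvPolynomial.algHom_ext
    intro v
    by_cases h1 : v = r <;> by_cases h2 : v = q <;> simp_all [sS_X]
  have h2 := DFunLike.congr_fun h1 f
  rw [AlgHom.comp_apply, AlgHom.comp_apply, AlgHom.comp_apply, hφ, h, map_zero] at h2
  exact h2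

/-- let `f` be symmetric separately in the `x` and `y` variables,
satisfying the Serre relations, and suppose `[0,1,…,l₃; 0,1,…,l₃]' f = 0`
(the `h₁^{l₃+1} = 0` condition: differentiate by `(∂/∂x_{i+1})^i`, `(∂/∂y_{i+1})^i`
for `0 ≤ i ≤ l₃` and set `x₁ = ⋯ = x_{l₃+1} = y₁ = ⋯ = y_{l₃+1} = 0`).
Then for every `s ≥ l₃` with `s+1 ≤ m`, `[0^{s+1}; s^{l₃+1}]' f = 0`:
`∏_{j=1}^{l₃+1} (∂/∂y_j)^s f` vanishes at `x₁ = ⋯ = x_{s+1} = y₁ = ⋯ = y_{l₃+1} = 0`. -/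
theorem stmt6 (m n l3 : ℕ) (f : MvPolynomial (Fin m ⊕ Fin n) ℚ)
    (hm0 : l3 + 1 ≤ m) (hn0 : l3 + 1 ≤ n)
    (hx : ∀ σ : Equiv.Perm (Fin m), rename (Sum.map σ id) f = f)
    (hy : ∀ σ : Equiv.Perm (Fin n), rename (Sum.map id σ) f = f)
    (hserre1 : ∀ (hm : 2 ≤ m) (hn : 1 ≤ n),
      aeval (fun v : Fin m ⊕ Fin n =>
        if v = Sum.inl ⟨1, hm⟩ ∨ v = Sum.inr ⟨0, hn⟩
        then (X (Sum.inl (⟨0, by omega⟩ : Fin m)) : MvPolynomial (Fin m ⊕ Fin n) ℚ)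
        else X v) f = 0)
    (hserre2 : ∀ (hm : 1 ≤ m) (hn : 2 ≤ n),
      aeval (fun v : Fin m ⊕ Fin n =>
        if v = Sum.inr (⟨0, by omega⟩ : Fin n) ∨ v = Sum.inr ⟨1, hn⟩
        then (X (Sum.inl (⟨0, hm⟩ : Fin m)) : MvPolynomial (Fin m ⊕ Fin n) ℚ)
        else X v) f = 0)
    (hh1 : aeval (Sum.elim
        (fun i : Fin m => if (i : ℕ) < l3 + 1
          then (0 : MvPolynomial (Fin m ⊕ Fin n) ℚ) else X (Sum.inl i))
        (fun j : Fin n => if (j : ℕ) < l3 + 1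
          then (0 : MvPolynomial (Fin m ⊕ Fin n) ℚ) else X (Sum.inr j)))
      (mderivY m n (fun j => if (j : ℕ) < l3 + 1 then (j : ℕ) else 0)
        (mderivX m n (fun i => if (i : ℕ) < l3 + 1 then (i : ℕ) else 0) f)) = 0) :
    ∀ s : ℕ, l3 ≤ s → s + 1 ≤ m →
      aeval (Sum.elim
          (fun i : Fin m => if (i : ℕ) < s + 1
            then (0 : MvPolynomial (Fin m ⊕ Fin n) ℚ) else X (Sum.inl i))
          (fun j : Fin n => if (j : ℕ) < l3 + 1
            then (0 : MvPolynomial (Fin m ⊕ Fin n) ℚ) else X (Sum.inr j)))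
        (mderivY m n (fun j => if (j : ℕ) < l3 + 1 then s else 0) f) = 0 := by
  intro s hls hsm
  have hφ : ∀ (σ : Equiv.Perm (Fin m)) (τ : Equiv.Perm (Fin n)),
      rename (Equiv.sumCongr σ τ) f = f := by
    intro σ τ
    have : (⇑(Equiv.sumCongr σ τ) : Fin m ⊕ Fin n → Fin m ⊕ Fin n) =
        Sum.map σ id ∘ Sum.map id τ := by
      funext v; rcases v with i | j <;> simp
    rw [this, ← rename_rename, hy, hx]
  let A : Finset (Fin m ⊕ Fin n) :=
    (Finset.univ.filter (fun i : Fin m => (i : ℕ) < s + 1)).map Function.Embedding.inl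
  let B : Finset (Fin m ⊕ Fin n) :=
    (Finset.univ.filter (fun j : Fin n => (j : ℕ) < l3 + 1)).map Function.Embedding.inr
  have hAc : A.card = s + 1 := by
    simp only [A, Finset.card_map, Fin.card_filter_val_lt]; omega
  have hBc : B.card = l3 + 1 := by
    simp only [B, Finset.card_map, Fin.card_filter_val_lt]; omega
  have hAB : Disjoint A B := by
    rw [Finset.disjoint_left]
    intro v hv hv'
    simp only [A, B, Finset.mem_map] at hv hv'
    obtain ⟨i, _, rfl⟩ := hv
    obtain ⟨j, _, h⟩ := hv'
    simp at h
  have hS : Serre A B f := by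
    intro p hp r hr q hq hqp hqr
    simp only [A, B, Finset.mem_map, Finset.mem_union] at hp hr hq
    obtain ⟨i, _, rfl⟩ := hp
    obtain ⟨j, _, rfl⟩ := hr
    rcases hq with ⟨i', _, rfl⟩ | ⟨j', _, rfl⟩
    · have hne : i ≠ i' := by rintro rfl; exact hqp rfl
      have hm2 : 2 ≤ m := by
        have := i.2; have := i'.2
        have : (i : ℕ) ≠ i' := fun h => hne (Fin.ext h)
        omega
      have hn1 : 1 ≤ n := by omega
      obtain ⟨σ, hσ⟩ := permExt hm2 ![i, i'] (by
        intro a b; fin_cases a <;> fin_cases b <;> simp [hne, hne.symm])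
      obtain ⟨τ, hτ⟩ := permExt hn1 ![j] (by
        intro a b _; exact Subsingleton.elim _ _)
      have h := serre_aux f _ (hφ σ τ) (Sum.inl ⟨0, by omega⟩) (Sum.inl ⟨1, hm2⟩)
        (Sum.inr ⟨0, hn1⟩) (by simp) (hserre1 hm2 hn1)
      have h0 : σ ⟨0, by omega⟩ = i := hσ 0
      have h1 : σ ⟨1, hm2⟩ = i' := hσ 1
      have h2 : τ ⟨0, hn1⟩ = j := hτ 0
      simpa [h0, h1, h2] using h
    · have hne : j ≠ j' := by rintro rfl; exact hqr rfl
      have hn2 : 2 ≤ n := by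
        have := j.2; have := j'.2
        have : (j : ℕ) ≠ j' := fun h => hne (Fin.ext h)
        omega
      have hm1 : 1 ≤ m := by omega
      obtain ⟨τ, hτ⟩ := permExt hn2 ![j', j] (by
        intro a b; fin_cases a <;> fin_cases b <;> simp [hne, hne.symm])
      obtain ⟨σ, hσ⟩ := permExt hm1 ![i] (by
        intro a b _; exact Subsingleton.elim _ _)
      have h := serre_aux f _ (hφ σ τ) (Sum.inl ⟨0, hm1⟩) (Sum.inr ⟨0, by omega⟩)
        (Sum.inr ⟨1, hn2⟩) (by simp) (hserre2 hm1 hn2)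
      have h0 : τ ⟨0, by omega⟩ = j' := hτ 0
      have h1 : τ ⟨1, hn2⟩ = j := hτ 1
      have h2 : σ ⟨0, hm1⟩ = i := hσ 0
      simpa [h0, h1, h2] using h
  have hC : Cond A B f := by
    intro e he1 he2
    rw [hBc] at he1 he2
    have hu : ∀ t : Fin (l3 + 1), ∃ i : Fin m, e (Sum.inl i) = t := by
      intro t
      obtain ⟨v, hv, hvt⟩ := Finset.mem_image.1 (he1 (Finset.mem_range.2 t.2))
      simp only [A, Finset.mem_map] at hv
      obtain ⟨i, _, rfl⟩ := hv
      exact ⟨i, hvt⟩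
    have hv : ∀ t : Fin (l3 + 1), ∃ j : Fin n, e (Sum.inr j) = t := by
      intro t
      obtain ⟨v, hv, hvt⟩ := Finset.mem_image.1 (he2 (Finset.mem_range.2 t.2))
      simp only [B, Finset.mem_map] at hv
      obtain ⟨j, _, rfl⟩ := hv
      exact ⟨j, hvt⟩
    choose u hu using hu
    choose w hw using hv
    obtain ⟨σ, hσ⟩ := permExt hm0 u (by
      intro a b hab; apply Fin.ext; rw [← hu a, ← hu b, hab])
    obtain ⟨τ, hτ⟩ := permExt hn0 w (by
      intro a b hab; apply Fin.ext; rw [← hw a, ← hw b, hab])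
    let φ := Equiv.sumCongr σ τ
    let d : (Fin m ⊕ Fin n) →₀ ℕ := Finsupp.equivFunOnFinite.symm (fun v => e (φ v))
    have hd : ∀ v, d v = e (φ v) := fun v => rfl
    have hde : Finsupp.mapDomain φ d = e := by
      ext v
      obtain ⟨v', rfl⟩ := φ.surjective v
      rw [Finsupp.mapDomain_apply φ.injective, hd]
    have hcd : coeff e f = coeff d f := by
      rw [← hφ σ τ, ← hde, coeff_rename_mapDomain φ φ.injective, hφ]
    rw [hcd]
    have hdX : ∀ i : Fin m, (i : ℕ) < l3 + 1 → d (Sum.inl i) = i := by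
      intro i hi
      rw [hd]
      have := hσ ⟨i, hi⟩
      simp only [Fin.castLE_mk] at this
      simp [φ, this, hu]
    have hdY : ∀ j : Fin n, (j : ℕ) < l3 + 1 → d (Sum.inr j) = j := by
      intro j hj
      rw [hd]
      have := hτ ⟨j, hj⟩
      simp only [Fin.castLE_mk] at this
      simp [φ, this, hw]
    let d0 : (Fin m ⊕ Fin n) →₀ ℕ := Finsupp.equivFunOnFinite.symm
      (Sum.elim (fun i => if (i : ℕ) < l3 + 1 then 0 else d (Sum.inl i))
        (fun j => if (j : ℕ) < l3 + 1 then 0 else d (Sum.inr j)))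
    rw [elim_eq] at hh1
    have h := congrArg (coeff d0) hh1
    classical
    rw [coeff_zero_sub, coeff_zero, if_pos] at h
    · obtain ⟨c, hc, h1⟩ := coeff_fold (fun j : Fin n => (Sum.inr j : Fin m ⊕ Fin n))
        (fun j => if (j : ℕ) < l3 + 1 then (j : ℕ) else 0) (List.finRange n)
        (mderivX m n (fun i => if (i : ℕ) < l3 + 1 then (i : ℕ) else 0) f) d0
      obtain ⟨c', hc', h2⟩ := coeff_fold (fun i : Fin m => (Sum.inl i : Fin m ⊕ Fin n))
        (fun j => if (j : ℕ) < l3 + 1 then (j : ℕ) else 0) (List.finRange m) f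
        (d0 + ((List.finRange n).map fun j => Finsupp.single (Sum.inr j : Fin m ⊕ Fin n)
          (if (j : ℕ) < l3 + 1 then (j : ℕ) else 0)).sum)
      unfold mderivY at h
      rw [h1] at h
      unfold mderivX at h
      rw [h2] at h
      have hfin := ((mul_eq_zero.1 h).resolve_left hc)
      have hfin := ((mul_eq_zero.1 hfin).resolve_left hc')
      convert hfin using 2
      ext v
      rw [Finsupp.add_apply, Finsupp.add_apply, sumY_apply, sumX_apply]
      rcases v with i | j
      · by_cases hi : (i : ℕ) < l3 + 1
        · simp only [d0, Finsupp.equivFunOnFinite_symm_apply_apply, Sum.elim_inl, if_pos hi, hdX i hi]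
          omega
        · simp only [d0, Finsupp.equivFunOnFinite_symm_apply_apply, Sum.elim_inl, if_neg hi]
          omega
      · by_cases hj : (j : ℕ) < l3 + 1
        · simp only [d0, Finsupp.equivFunOnFinite_symm_apply_apply, Sum.elim_inr, if_pos hj, hdY j hj]
          omega
        · simp only [d0, Finsupp.equivFunOnFinite_symm_apply_apply, Sum.elim_inr, if_neg hj]
          omega
    · intro v hv
      rcases v with i | j <;> simp at hv <;> simp [d0, hv]
  rw [elim_eq]
  ext e
  classical
  rw [coeff_zero_sub, coeff_zero]
  split_ifs with he
  swap
  · rfl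
  obtain ⟨c, hc, h1⟩ := coeff_fold (fun j : Fin n => (Sum.inr j : Fin m ⊕ Fin n))
        (fun j => if (j : ℕ) < l3 + 1 then s else 0) (List.finRange n) f e
  unfold mderivY
  rw [h1, mainAbs A B hAB f hS hC _ s hAc, mul_zero]
  · intro v hv
    simp only [A, Finset.mem_map, Finset.mem_filter, Finset.mem_univ, true_and] at hv
    obtain ⟨i, hi, rfl⟩ := hv
    rw [Finsupp.add_apply, sumY_apply, he _ (by simpa using hi)]
    rfl
  · intro v hv
    simp only [B, Finset.mem_map, Finset.mem_filter, Finset.mem_univ, true_and] at hv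
    obtain ⟨j, hj, rfl⟩ := hv
    rw [Finsupp.add_apply, sumY_apply, he _ (by simpa using hj)]
    simp only [zero_add]
    exact if_pos hj
end
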